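/- arXiv:1901.06544 — 3 statements merged into one kernel-verified Lean document; each statement's English description precedes it below -/
import Mathlib

section
/- Let μ and ν be finite Borel measures on a complete separable metric space Z. Then dP(μ,ν) = min{ε ≥ 0 : there exists a finite Borel measure α on Z × Z with D(α;μ,ν) + α({(x,y) ∈ Z × Z : d(x,y) > ε}) ≤ ε}, and this minimum is attained. In particular, for every ε ≥ 0, dP(μ,ν) ≤ ε if and only if such a measure α exists. -/
open MeasureTheory Topology Filter

noncomputable section

/-- Prokhorov distance between finite Borel measures on a metric space. -/
def prokhorovDist {Z : Type*} [MetricSpace Z] [MeasurableSpace Z]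
    (μ ν : Measure Z) : ℝ :=
  sInf {ε : ℝ | 0 < ε ∧ ∀ A : Set Z, IsClosed A →
    μ A ≤ ν (Metric.cthickening ε A) + ENNReal.ofReal ε ∧
    ν A ≤ μ (Metric.cthickening ε A) + ENNReal.ofReal ε}

/-- Total variation distance between finite measures. -/
def tvDist {Z : Type*} [MeasurableSpace Z] (μ ν : Measure Z) : ℝ :=
  sSup {x : ℝ | ∃ A : Set Z, MeasurableSet A ∧ x = |(μ A).toReal - (ν A).toReal|}

/-- Discrepancy of a measure `α` on a product with respect to marginals `μ`, `ν`. -/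
def discrepancy {X Y : Type*} [MeasurableSpace X] [MeasurableSpace Y]
    (α : Measure (X × Y)) (μ : Measure X) (ν : Measure Y) : ℝ :=
  tvDist (α.map Prod.fst) μ + tvDist (α.map Prod.snd) ν


lemma natFlow {ι : Type} [Fintype ι] [DecidableEq ι] (r : ι → ι → Prop) [DecidableRel r]
    (p q : ι → ℕ) (d : ℕ)
    (h : ∀ S : Finset ι, ∑ i ∈ S, p i ≤
      ∑ j ∈ Finset.univ.filter (fun j => ∃ i ∈ S, r i j), q j + d) :
    ∃ N : ι → ι → ℕ, (∀ i j, ¬ r i j → N i j = 0) ∧ (∀ i, ∑ j, N i j ≤ p i) ∧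
      (∀ j, ∑ i, N i j ≤ q j) ∧ ∑ i, p i ≤ ∑ i, ∑ j, N i j + d := by
  classical
  let R : (Σ i, Fin (p i)) → ((Σ j, Fin (q j)) ⊕ Fin d) → Prop := fun x y =>
    ∀ z, y = Sum.inl z → r x.1 z.1
  obtain ⟨f, hf, hR⟩ := (Fintype.all_card_le_filter_rel_iff_exists_injective R).1 (by
    intro A
    rcases A.eq_empty_or_nonempty with rfl | ⟨a0, ha0⟩
    · simp
    let S := A.image Sigma.fst
    have h1 : A.card ≤ ∑ i ∈ S, p i := by
      calc A.card ≤ (S.sigma (fun i => (Finset.univ : Finset (Fin (p i))))).card := by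
            apply Finset.card_le_card
            intro x hx
            simp only [Finset.mem_sigma, Finset.mem_univ, and_true, S]
            exact Finset.mem_image_of_mem _ hx
        _ = _ := by simp [Finset.card_sigma]
    refine h1.trans ((h S).trans ?_)
    calc _ = (((Finset.univ.filter (fun j => ∃ i ∈ S, r i j)).sigma
          (fun j => (Finset.univ : Finset (Fin (q j))))).disjSum
            (Finset.univ : Finset (Fin d))).card := by
            simp [Finset.card_disjSum, Finset.card_sigma]
      _ ≤ _ := by
        apply Finset.card_le_card
        intro y hy
        simp only [Finset.mem_filter, Finset.mem_univ, true_and]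
        rcases y with y | y
        · simp only [Finset.inl_mem_disjSum, Finset.mem_sigma, Finset.mem_filter,
            Finset.mem_univ, true_and, and_true, S, Finset.mem_image] at hy
          obtain ⟨i, ⟨a, ha, rfl⟩, hr⟩ := hy
          refine ⟨a, ha, ?_⟩
          intro z hz
          cases hz
          exact hr
        · exact ⟨a0, ha0, fun z hz => by cases hz⟩)
  let F : ι → ι → Finset (Σ i, Fin (p i)) := fun i j =>
    Finset.univ.filter (fun x => x.1 = i ∧ ∃ y, f x = Sum.inl y ∧ y.1 = j)
  refine ⟨fun i j => (F i j).card, ?_, ?_, ?_, ?_⟩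
  · intro i j hij
    rw [Finset.card_eq_zero, Finset.eq_empty_iff_forall_notMem]
    intro x hx
    simp only [F, Finset.mem_filter, Finset.mem_univ, true_and] at hx
    obtain ⟨rfl, y, hy, rfl⟩ := hx
    exact hij (hR x y hy)
  · intro i
    rw [← Finset.card_biUnion]
    · calc _ ≤ (({i} : Finset ι).sigma (fun i => (Finset.univ : Finset (Fin (p i))))).card := by
            apply Finset.card_le_card
            intro x hx
            simp only [F, Finset.mem_biUnion, Finset.mem_filter, Finset.mem_univ, true_and] at hx
            obtain ⟨j, hx, -⟩ := hx
            simp [hx]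
        _ = _ := by simp [Finset.card_sigma]
    · intro j _ j' _ hjj
      rw [Function.onFun, Finset.disjoint_left]
      intro x hx hx'
      simp only [F, Finset.mem_filter, Finset.mem_univ, true_and] at hx hx'
      obtain ⟨-, y, hy, rfl⟩ := hx
      obtain ⟨-, y', hy', rfl⟩ := hx'
      rw [hy] at hy'
      cases hy'
      exact hjj rfl
  · intro j
    rw [← Finset.card_biUnion]
    · calc _ ≤ ((({j} : Finset ι).sigma
            (fun i => (Finset.univ : Finset (Fin (q i))))).map ⟨Sum.inl (β := Fin d), Sum.inl_injective⟩).card := by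
            apply Finset.card_le_card_of_injOn f
            · intro x hx
              simp only [F, Finset.coe_biUnion, Finset.coe_filter, Finset.mem_univ, true_and, Set.mem_iUnion, Set.mem_ofPred_eq, Finset.coe_univ, Set.mem_univ, exists_prop] at hx
              obtain ⟨i, -, y, hy, rfl⟩ := hx
              simp [hy]
            · exact hf.injOn
        _ = _ := by simp [Finset.card_sigma]
    · intro j _ j' _ hjj
      rw [Function.onFun, Finset.disjoint_left]
      intro x hx hx'
      simp only [F, Finset.mem_filter, Finset.mem_univ, true_and] at hx hx'
      exact hjj (hx.1.symm.trans hx'.1)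
  · have h0 : (Finset.univ.filter (fun x => ∃ k, f x = Sum.inr k)).card ≤ d := by
      calc _ ≤ ((Finset.univ : Finset (Fin d)).map ⟨Sum.inr (α := Σ j, Fin (q j)), Sum.inr_injective⟩).card := by
            apply Finset.card_le_card_of_injOn f
            · intro x hx
              simp only [Finset.coe_filter, Finset.mem_univ, true_and, Set.mem_ofPred_eq] at hx
              obtain ⟨k, hk⟩ := hx
              simp [hk]
            · exact hf.injOn
        _ = _ := by simp
    calc ∑ i, p i = (Finset.univ : Finset (Σ i, Fin (p i))).card := by simp
      _ ≤ ((Finset.univ.biUnion (fun i => Finset.univ.biUnion (fun j => F i j))) ∪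
            (Finset.univ.filter (fun x => ∃ k, f x = Sum.inr k))).card := by
          apply Finset.card_le_card
          intro x _
          simp only [Finset.mem_union, Finset.mem_biUnion, F, Finset.mem_filter, Finset.mem_univ, true_and]
          rcases hfx : f x with y | k
          · left; exact ⟨_, _, rfl, y, rfl, rfl⟩
          · right; exact ⟨k, rfl⟩
      _ ≤ _ := (Finset.card_union_le _ _).trans (add_le_add
          (Finset.card_biUnion_le.trans (Finset.sum_le_sum fun i _ => Finset.card_biUnion_le)) h0)

lemma realFlow {ι : Type} [Fintype ι] [DecidableEq ι] (r : ι → ι → Prop) [DecidableRel r]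
    (a b : ι → ℝ) (ha : ∀ i, 0 ≤ a i) (hb : ∀ i, 0 ≤ b i) (η δ : ℝ) (hη : 0 ≤ η) (hδ : 0 < δ)
    (h : ∀ S : Finset ι, ∑ i ∈ S, a i ≤
      ∑ j ∈ Finset.univ.filter (fun j => ∃ i ∈ S, r i j), b j + η) :
    ∃ w : ι → ι → ℝ, (∀ i j, 0 ≤ w i j) ∧ (∀ i j, ¬ r i j → w i j = 0) ∧
      (∀ i, ∑ j, w i j ≤ a i) ∧
      (∀ j, ∑ i, w i j ≤ b j) ∧ ∑ i, a i ≤ ∑ i, ∑ j, w i j + η + δ := by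
  set k : ℕ := Fintype.card ι with hk
  obtain ⟨n, hn⟩ := exists_nat_gt ((2 * k + 1) / δ)
  have hn0 : (0 : ℝ) < n := lt_of_le_of_lt (by positivity) hn
  rw [div_lt_iff₀ hδ] at hn
  have hb' : ∀ S : Finset ι, n * ∑ j ∈ S, b j ≤ ((∑ j ∈ S, ⌊n * b j⌋₊ : ℕ) : ℝ) + k := by
    intro S
    calc n * ∑ j ∈ S, b j = ∑ j ∈ S, n * b j := by rw [Finset.mul_sum]
      _ ≤ ∑ j ∈ S, ((⌊n * b j⌋₊ : ℝ) + 1) :=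
        Finset.sum_le_sum fun j _ => (Nat.lt_floor_add_one _).le
      _ = ((∑ j ∈ S, ⌊n * b j⌋₊ : ℕ) : ℝ) + S.card := by
        push_cast; rw [Finset.sum_add_distrib]; simp
      _ ≤ _ := by
        have : S.card ≤ k := Finset.card_le_univ S
        gcongr
  obtain ⟨N, h1, h2, h3, h4⟩ := natFlow r (fun i => ⌊n * a i⌋₊) (fun i => ⌊n * b i⌋₊)
    (k + ⌈n * η⌉₊) (by
      intro S
      have e1 : ((∑ i ∈ S, ⌊n * a i⌋₊ : ℕ) : ℝ) ≤ n * ∑ i ∈ S, a i := by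
        push_cast
        rw [Finset.mul_sum]
        exact Finset.sum_le_sum fun i _ => Nat.floor_le (mul_nonneg hn0.le (ha i))
      have e2 := mul_le_mul_of_nonneg_left (h S) hn0.le
      have e3 := hb' (Finset.univ.filter (fun j => ∃ i ∈ S, r i j))
      have e4 := Nat.le_ceil (n * η)
      rw [mul_add] at e2
      have : ((∑ i ∈ S, ⌊n * a i⌋₊ : ℕ) : ℝ) ≤ ((∑ j ∈ Finset.univ.filter (fun j => ∃ i ∈ S, r i j), ⌊n * b j⌋₊ + (k + ⌈n * η⌉₊) : ℕ) : ℝ) := by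
        rw [Nat.cast_add, Nat.cast_add]
        linarith
      exact_mod_cast this)
  have key : ∀ c : ℝ, 0 ≤ c → ∀ m : ℕ, m ≤ ⌊n * c⌋₊ → (m : ℝ) / n ≤ c := by
    intro c hc m hm
    rw [div_le_iff₀ hn0, mul_comm]
    exact (Nat.cast_le.2 hm).trans (Nat.floor_le (by positivity))
  refine ⟨fun i j => N i j / n, fun i j => by positivity, fun i j hij => by simp [h1 i j hij],
    ?_, ?_, ?_⟩
  · intro i
    rw [← Finset.sum_div]
    exact_mod_cast key _ (ha i) _ (h2 i)
  · intro i
    rw [← Finset.sum_div]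
    exact_mod_cast key _ (hb i) _ (h3 i)
  · simp_rw [← Finset.sum_div]
    have e1 : n * ∑ i, a i ≤ ((∑ i, ⌊n * a i⌋₊ : ℕ) : ℝ) + k := by
      calc n * ∑ j, a j = ∑ j, n * a j := by rw [Finset.mul_sum]
      _ ≤ ∑ j, ((⌊n * a j⌋₊ : ℝ) + 1) :=
        Finset.sum_le_sum fun j _ => (Nat.lt_floor_add_one _).le
      _ = _ := by
        push_cast; rw [Finset.sum_add_distrib]; simp [hk]
    have e2 : ((∑ i, ⌊n * a i⌋₊ : ℕ) : ℝ) ≤ ∑ i, ∑ j, (N i j : ℝ) + (k + ⌈n * η⌉₊) := by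
      exact_mod_cast h4
    have e3 := Nat.ceil_lt_add_one (mul_nonneg hn0.le hη)
    rw [← mul_le_mul_iff_right₀ hn0, mul_add, mul_add, mul_div_cancel₀ _ hn0.ne']
    linarith

lemma strassen_approx {Z : Type*} [MetricSpace Z] [Nonempty Z]
    [TopologicalSpace.SeparableSpace Z] [MeasurableSpace Z] [BorelSpace Z]
    (μ ν : Measure Z) [IsFiniteMeasure μ] [IsFiniteMeasure ν] (ε : ℝ) (hε : 0 ≤ ε)
    (h : ∀ A : Set Z, IsClosed A → μ A ≤ ν (Metric.cthickening ε A) + ENNReal.ofReal ε)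
    (δ : ℝ) (hδ : 0 < δ) :
    ∃ α : Measure (Z × Z), α.map Prod.fst ≤ μ ∧ α.map Prod.snd ≤ ν ∧
      α {p | ε + 5 * δ < dist p.1 p.2} = 0 ∧
      μ Set.univ ≤ α Set.univ + ENNReal.ofReal (ε + 3 * δ) := by
  classical
  have : SecondCountableTopology Z := UniformSpace.secondCountable_of_separable Z
  let x : ℕ → Z := TopologicalSpace.denseSeq Z
  let E' : ℕ → Set Z := disjointed (fun n => Metric.ball (x n) δ)
  have hEm' : ∀ n, MeasurableSet (E' n) :=
    MeasurableSet.disjointed fun n => Metric.isOpen_ball.measurableSet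
  have hEd' : Pairwise (Function.onFun Disjoint E') := disjoint_disjointed _
  have hEb' : ∀ n, ∀ y ∈ E' n, dist y (x n) < δ := fun n y hy =>
    Metric.mem_ball.1 (disjointed_subset (fun n => Metric.ball (x n) δ) n hy)
  have hEU : ⋃ n, E' n = Set.univ := by
    rw [iUnion_disjointed]
    apply Set.eq_univ_of_forall
    intro y
    obtain ⟨n, hn⟩ := (TopologicalSpace.denseRange_denseSeq Z).exists_dist_lt y hδ
    exact Set.mem_iUnion.2 ⟨n, hn⟩
  obtain ⟨k, hk⟩ : ∃ k : ℕ, (μ + ν) (⋃ i : Fin k, E' i)ᶜ ≤ ENNReal.ofReal δ := by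
    have ht := ENNReal.tendsto_nat_tsum (fun n => (μ + ν) (E' n))
    rw [← measure_iUnion hEd' hEm', hEU] at ht
    have hlt : (μ + ν) Set.univ < (μ + ν) Set.univ + ENNReal.ofReal δ :=
      ENNReal.lt_add_right (measure_ne_top _ _) (by simpa using hδ)
    have ht2 := ht.add_const (ENNReal.ofReal δ)
    obtain ⟨k, hk⟩ := (ht2.eventually (lt_mem_nhds hlt)).exists
    refine ⟨k, ?_⟩
    have hU : (μ + ν) (⋃ i : Fin k, E' i) = ∑ i ∈ Finset.range k, (μ + ν) (E' i) := by
      rw [measure_iUnion (f := fun i : Fin k => E' i)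
        (fun i j hij => hEd' (fun h => hij (Fin.ext h))) (fun i => hEm' i),
        tsum_fintype, Fin.sum_univ_eq_sum_range (fun i => (μ + ν) (E' i))]
    have hadd := measure_add_measure_compl (μ := μ + ν)
      (MeasurableSet.iUnion fun i : Fin k => hEm' i)
    rw [← hU, ← hadd] at hk
    exact (ENNReal.add_le_add_iff_left (measure_ne_top _ _)).1 hk.le
  let E : Fin k → Set Z := fun i => E' i
  have hEm : ∀ n, MeasurableSet (E n) := fun n => hEm' n
  have hEd : Pairwise (Function.onFun Disjoint E) := fun i j hij => hEd' (fun h => hij (Fin.ext h))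
  have hEb : ∀ n, ∀ y ∈ E n, dist y (x n) < δ := fun n => hEb' n
  have hμk : μ (⋃ i, E i)ᶜ ≤ ENNReal.ofReal δ :=
    le_trans (by rw [Measure.add_apply]; exact le_self_add) hk
  have hνk : ν (⋃ i, E i)ᶜ ≤ ENNReal.ofReal δ :=
    le_trans (by rw [Measure.add_apply]; exact le_add_self) hk
  have hsum : ∀ (ρ : Measure Z) [IsFiniteMeasure ρ] (S : Finset (Fin k)),
      ρ (⋃ i ∈ S, E i) = ENNReal.ofReal (∑ i ∈ S, ρ.real (E i)) := by
    intro ρ _ S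
    rw [measure_biUnion_finset (fun i _ j _ hij => hEd hij) (fun i _ => hEm i),
      ENNReal.ofReal_sum_of_nonneg (fun _ _ => measureReal_nonneg)]
    exact Finset.sum_congr rfl fun i _ => (ofReal_measureReal).symm
  obtain ⟨r, hrdef⟩ : ∃ r : Fin k → Fin k → Prop, ∀ i j, r i j ↔ dist (x i) (x j) ≤ ε + 3 * δ :=
    ⟨fun i j => dist (x i) (x j) ≤ ε + 3 * δ, fun _ _ => Iff.rfl⟩
  obtain ⟨w, hw0, hwr, hwa, hwb, hw⟩ := realFlow r (fun i => μ.real (E i)) (fun i => ν.real (E i))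
    (fun _ => measureReal_nonneg) (fun _ => measureReal_nonneg) (ε + δ) δ (by positivity) hδ (by
      intro S
      suffices hT : ∀ T : Finset (Fin k), (∀ j, j ∈ T ↔ ∃ i ∈ S, r i j) →
          ∑ i ∈ S, μ.real (E i) ≤ ∑ j ∈ T, ν.real (E j) + (ε + δ) from hT _ (by simp)
      intro T hT
      have hs : 0 ≤ ∑ j ∈ T, ν.real (E j) :=
        Finset.sum_nonneg fun _ _ => measureReal_nonneg
      rw [← ENNReal.ofReal_le_ofReal_iff (by positivity), ENNReal.ofReal_add hs (by positivity),
        ← hsum, ← hsum, ENNReal.ofReal_add hε hδ.le]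
      have hsub : Metric.cthickening ε (⋃ i ∈ S, E i) ⊆
          (⋃ j ∈ T, E j) ∪ (⋃ i, E i)ᶜ := by
        intro y hy
        by_cases hyU : y ∈ ⋃ i, E i
        · left
          obtain ⟨j, hj⟩ := Set.mem_iUnion.1 hyU
          have := Metric.cthickening_subset_thickening' (show 0 < ε + δ by positivity)
            (show ε < ε + δ by linarith) _ hy
          obtain ⟨z, hz, hyz⟩ := Metric.mem_thickening_iff.1 this
          simp only [Set.mem_iUnion] at hz
          obtain ⟨i, hi, hz⟩ := hz
          simp only [Set.mem_iUnion]
          refine ⟨j, (hT j).2 ⟨i, hi, ?_⟩, hj⟩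
          have h1 := hEb _ _ hj
          have h2 := hEb _ _ hz
          have h3 := dist_triangle4 (x i) z y (x j)
          rw [dist_comm (x i) z, dist_comm z y] at h3
          rw [hrdef]
          linarith
        · right; exact hyU
      calc μ (⋃ i ∈ S, E i) ≤ μ (closure (⋃ i ∈ S, E i)) := measure_mono subset_closure
        _ ≤ ν (Metric.cthickening ε (⋃ i ∈ S, E i)) + ENNReal.ofReal ε := by
          have := h _ (isClosed_closure (s := ⋃ i ∈ S, E i))
          rwa [Metric.cthickening_closure] at this
        _ ≤ (ν (⋃ j ∈ T, E j) + ENNReal.ofReal δ)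
            + ENNReal.ofReal ε := by
          gcongr
          exact (measure_mono hsub).trans ((measure_union_le _ _).trans (by gcongr))
        _ = _ := by rw [add_assoc, add_comm (ENNReal.ofReal δ)])
  let c : Fin k → Fin k → ENNReal := fun i j =>
    ENNReal.ofReal (w i j / (μ.real (E i) * ν.real (E j)))
  have hwle1 : ∀ i j, w i j ≤ μ.real (E i) := fun i j =>
    (Finset.single_le_sum (f := fun j => w i j) (fun j _ => hw0 i j) (Finset.mem_univ j)).trans
      (hwa i)
  have hwle2 : ∀ i j, w i j ≤ ν.real (E j) := fun i j =>
    (Finset.single_le_sum (f := fun i => w i j) (fun i _ => hw0 i j) (Finset.mem_univ i)).trans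
      (hwb j)
  have hcm : ∀ i j, c i j * (μ (E i) * ν (E j)) = ENNReal.ofReal (w i j) := by
    intro i j
    rw [← ofReal_measureReal (μ := μ), ← ofReal_measureReal (μ := ν),
      ← ENNReal.ofReal_mul measureReal_nonneg,
      ← ENNReal.ofReal_mul (div_nonneg (hw0 i j) (by positivity))]
    congr 1
    by_cases h0 : μ.real (E i) * ν.real (E j) = 0
    · rw [h0, mul_zero]
      rcases mul_eq_zero.1 h0 with h0 | h0
      · exact le_antisymm (hw0 i j) ((hwle1 i j).trans h0.le)
      · exact le_antisymm (hw0 i j) ((hwle2 i j).trans h0.le)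
    · exact div_mul_cancel₀ _ h0
  have hcν : ∀ i j, c i j * ν (E j) ≤ ENNReal.ofReal (w i j / μ.real (E i)) := by
    intro i j
    rw [← ofReal_measureReal (μ := ν),
      ← ENNReal.ofReal_mul (div_nonneg (hw0 i j) (by positivity))]
    apply ENNReal.ofReal_le_ofReal
    by_cases h0 : ν.real (E j) = 0
    · rw [h0]; simpa using div_nonneg (hw0 i j) measureReal_nonneg
    · rw [← div_div, div_mul_cancel₀ _ h0]
  have hcμ : ∀ i j, c i j * μ (E i) ≤ ENNReal.ofReal (w i j / ν.real (E j)) := by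
    intro i j
    rw [← ofReal_measureReal (μ := μ),
      ← ENNReal.ofReal_mul (div_nonneg (hw0 i j) (by positivity))]
    apply ENNReal.ofReal_le_ofReal
    by_cases h0 : μ.real (E i) = 0
    · rw [h0]; simpa using div_nonneg (hw0 i j) measureReal_nonneg
    · rw [mul_comm (μ.real (E i)), ← div_div, div_mul_cancel₀ _ h0]
  let α : Measure (Z × Z) := ∑ i, ∑ j, c i j • (μ.restrict (E i)).prod (ν.restrict (E j))
  have hα : ∀ s, α s = ∑ i, ∑ j, c i j * (μ.restrict (E i)).prod (ν.restrict (E j)) s := by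
    intro s
    simp [α, Measure.finsetSum_apply]
  have hpart : ∀ (ρ : Measure Z) (s : Set Z), MeasurableSet s → ∑ i, ρ (s ∩ E i) ≤ ρ s := by
    intro ρ s hs
    rw [← tsum_fintype (L := SummationFilter.unconditional _), ← measure_iUnion
      (fun i j hij => (hEd hij).mono Set.inter_subset_right Set.inter_subset_right)
      (fun i => hs.inter (hEm i))]
    exact measure_mono (Set.iUnion_subset fun i => Set.inter_subset_left)
  refine ⟨α, ?_, ?_, ?_, ?_⟩
  · rw [Measure.le_iff]
    intro s hs
    refine le_trans ?_ (hpart μ s hs)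
    rw [Measure.map_apply measurable_fst hs, hα]
    refine Finset.sum_le_sum fun i _ => ?_
    calc ∑ j, c i j * (μ.restrict (E i)).prod (ν.restrict (E j)) (Prod.fst ⁻¹' s)
        = ∑ j, (c i j * ν (E j)) * μ (s ∩ E i) := by
          refine Finset.sum_congr rfl fun j _ => ?_
          rw [← Measure.map_apply measurable_fst hs, Measure.map_fst_prod, Measure.smul_apply,
            Measure.restrict_apply_univ, Measure.restrict_apply hs, smul_eq_mul, mul_assoc]
      _ ≤ ∑ j, ENNReal.ofReal (w i j / μ.real (E i)) * μ (s ∩ E i) := by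
          gcongr with j; exact hcν i j
      _ = ENNReal.ofReal ((∑ j, w i j) / μ.real (E i)) * μ (s ∩ E i) := by
          rw [← Finset.sum_mul, Finset.sum_div, ENNReal.ofReal_sum_of_nonneg]
          exact fun j _ => div_nonneg (hw0 i j) measureReal_nonneg
      _ ≤ 1 * μ (s ∩ E i) := by
          gcongr
          rw [ENNReal.ofReal_le_one]
          exact div_le_one_of_le₀ (hwa i) measureReal_nonneg
      _ = _ := one_mul _
  · rw [Measure.le_iff]
    intro s hs
    refine le_trans ?_ (hpart ν s hs)
    rw [Measure.map_apply measurable_snd hs, hα, Finset.sum_comm]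
    refine Finset.sum_le_sum fun j _ => ?_
    calc ∑ i, c i j * (μ.restrict (E i)).prod (ν.restrict (E j)) (Prod.snd ⁻¹' s)
        = ∑ i, (c i j * μ (E i)) * ν (s ∩ E j) := by
          refine Finset.sum_congr rfl fun i _ => ?_
          rw [← Measure.map_apply measurable_snd hs, Measure.map_snd_prod, Measure.smul_apply,
            Measure.restrict_apply_univ, Measure.restrict_apply hs, smul_eq_mul, mul_assoc]
      _ ≤ ∑ i, ENNReal.ofReal (w i j / ν.real (E j)) * ν (s ∩ E j) := by
          gcongr with i; exact hcμ i j
      _ = ENNReal.ofReal ((∑ i, w i j) / ν.real (E j)) * ν (s ∩ E j) := by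
          rw [← Finset.sum_mul, Finset.sum_div, ENNReal.ofReal_sum_of_nonneg]
          exact fun i _ => div_nonneg (hw0 i j) measureReal_nonneg
      _ ≤ 1 * ν (s ∩ E j) := by
          gcongr
          rw [ENNReal.ofReal_le_one]
          exact div_le_one_of_le₀ (hwb j) measureReal_nonneg
      _ = _ := one_mul _
  · rw [hα]
    refine Finset.sum_eq_zero fun i _ => Finset.sum_eq_zero fun j _ => ?_
    by_cases hr : r i j
    · have hmeas : MeasurableSet {p : Z × Z | ε + 5 * δ < dist p.1 p.2} :=
        (isOpen_lt continuous_const continuous_dist).measurableSet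
      rw [Measure.prod_restrict, Measure.restrict_apply hmeas]
      have : {p : Z × Z | ε + 5 * δ < dist p.1 p.2} ∩ E i ×ˢ E j = ∅ := by
        rw [Set.eq_empty_iff_forall_notMem]
        rintro ⟨y, z⟩ ⟨h1, h2, h3⟩
        have h4 := hEb _ _ h2
        have h5 := hEb _ _ h3
        have h6 := dist_triangle4 y (x i) (x j) z
        rw [dist_comm (x j) z] at h6
        change ε + 5 * δ < dist y z at h1
        rw [hrdef] at hr
        simp only at h4 h5
        linarith
      rw [this, measure_empty, mul_zero]
    · simp [c, hwr i j hr]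
  · have hm : α Set.univ = ENNReal.ofReal (∑ i, ∑ j, w i j) := by
      rw [hα, ENNReal.ofReal_sum_of_nonneg (fun i _ => Finset.sum_nonneg fun j _ => hw0 i j)]
      refine Finset.sum_congr rfl fun i _ => ?_
      rw [ENNReal.ofReal_sum_of_nonneg (fun j _ => hw0 i j)]
      refine Finset.sum_congr rfl fun j _ => ?_
      rw [← Set.univ_prod_univ, Measure.prod_prod, Measure.restrict_apply_univ,
        Measure.restrict_apply_univ, hcm]
    have hsn : 0 ≤ ∑ i, ∑ j, w i j := Finset.sum_nonneg fun i _ => Finset.sum_nonneg fun j _ => hw0 i j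
    rw [← measure_add_measure_compl (MeasurableSet.iUnion hEm)]
    have hU := hsum μ Finset.univ
    simp only [Finset.mem_univ, Set.iUnion_true] at hU
    calc _ ≤ ENNReal.ofReal (∑ i, μ.real (E i)) + ENNReal.ofReal δ := by rw [hU]; gcongr
      _ ≤ ENNReal.ofReal (∑ i, ∑ j, w i j + (ε + δ) + δ) + ENNReal.ofReal δ := by gcongr
      _ = _ := by
        rw [hm, ← ENNReal.ofReal_add (by positivity) hδ.le,
          ← ENNReal.ofReal_add hsn (by positivity)]
        congr 1; ring

lemma limit_open {X ι : Type*} [MeasurableSpace X] [TopologicalSpace X] [HasOuterApproxClosed X]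
    [OpensMeasurableSpace X] {L : Filter ι} [L.NeBot] {α : FiniteMeasure X}
    {αs : ι → FiniteMeasure X} (hl : Tendsto αs L (𝓝 α)) {G : Set X} (hG : IsOpen G) (c : ENNReal)
    (hc : ∀ᶠ i in L, (αs i : Measure X) G ≤ c) : (α : Measure X) G ≤ c := by
  have hmass : Tendsto (fun i => (αs i : Measure X) Set.univ) L (𝓝 ((α : Measure X) Set.univ)) := by
    have := (FiniteMeasure.continuous_mass.tendsto α).comp hl
    have := ENNReal.tendsto_coe.2 this
    simpa [Function.comp_def] using this
  have hlim := FiniteMeasure.limsup_measure_closed_le_of_tendsto hl hG.isClosed_compl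
  have key : (α : Measure X) Set.univ ≤ c + (α : Measure X) Gᶜ := by
    apply ENNReal.le_of_forall_pos_le_add
    intro e he _
    have hlt : L.limsup (fun i => (αs i : Measure X) Gᶜ) < (α : Measure X) Gᶜ + e :=
      hlim.trans_lt (ENNReal.lt_add_right (measure_ne_top _ _) (by simpa using he.ne'))
    refine le_of_tendsto hmass ?_
    filter_upwards [eventually_lt_of_limsup_lt hlt, hc] with i h1 h2
    rw [← measure_add_measure_compl hG.measurableSet, add_assoc]
    exact add_le_add h2 h1.le
  rw [← measure_add_measure_compl hG.measurableSet] at key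
  exact (ENNReal.add_le_add_iff_right (measure_ne_top _ _)).1 key

lemma strassen_sub {Z : Type*} [MetricSpace Z] [CompleteSpace Z]
    [TopologicalSpace.SeparableSpace Z] [MeasurableSpace Z] [BorelSpace Z]
    (μ ν : Measure Z) [IsFiniteMeasure μ] [IsFiniteMeasure ν] (ε : ℝ) (hε : 0 ≤ ε)
    (h : ∀ A : Set Z, IsClosed A → μ A ≤ ν (Metric.cthickening ε A) + ENNReal.ofReal ε) :
    ∃ α : Measure (Z × Z), IsFiniteMeasure α ∧ α.map Prod.fst ≤ μ ∧ α.map Prod.snd ≤ ν ∧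
      α {p | ε < dist p.1 p.2} = 0 ∧
      μ Set.univ ≤ α Set.univ + ENNReal.ofReal ε := by
  rcases isEmpty_or_nonempty Z with hZ | hZ
  · refine ⟨0, inferInstance, by simp, by simp, by simp, ?_⟩
    rw [Set.univ_eq_empty_iff.2 hZ]; simp
  have : SecondCountableTopology Z := UniformSpace.secondCountable_of_separable Z
  let δ : ℕ → ℝ := fun n => 1 / ((n : ℝ) + 1)
  have hδ : ∀ n, 0 < δ n := fun n => by positivity
  have hδl : Tendsto δ atTop (𝓝 0) := tendsto_one_div_add_atTop_nhds_zero_nat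
  choose β hβ1 hβ2 hβ3 hβ4 using fun n => strassen_approx μ ν ε hε h (δ n) (hδ n)
  have hβu : ∀ n, β n Set.univ ≤ μ Set.univ := by
    intro n
    have := hβ1 n Set.univ
    rwa [Measure.map_apply measurable_fst MeasurableSet.univ, Set.preimage_univ] at this
  have hβf : ∀ n, IsFiniteMeasure (β n) := fun n =>
    ⟨(hβu n).trans_lt (measure_lt_top _ _)⟩
  let αs : ℕ → FiniteMeasure (Z × Z) := fun n => ⟨β n, hβf n⟩
  have htight : ∀ (ρ : Measure Z) [IsFiniteMeasure ρ] (n : ℕ), ∃ K : Set Z, IsCompact K ∧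
      ρ Kᶜ ≤ ENNReal.ofReal (δ n) := by
    intro ρ _ n
    have := (isTightMeasureSet_iff_exists_isCompact_measure_compl_le.1
      (isTightMeasureSet_singleton (μ := ρ))) (ENNReal.ofReal (δ n)) (by simpa using hδ n)
    simpa using this
  choose K1 hK1 hK1' using htight μ
  choose K2 hK2 hK2' using htight ν
  let u : ℕ → NNReal := fun n => Real.toNNReal (δ n + δ n)
  have hu : Tendsto u atTop (𝓝 0) := by
    have := (continuous_real_toNNReal.tendsto _).comp (hδl.add hδl)
    simpa [Function.comp_def, u] using this
  have hcomp := isCompact_setOfPred_finiteMeasure_mass_le_compl_isCompact_le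
    (E := Z × Z) (u := u) (K := fun n => K1 n ×ˢ K2 n) (μ Set.univ).toNNReal hu
    (fun n => (hK1 n).prod (hK2 n)) (Or.inl inferInstance)
  let F : Ultrafilter ℕ := Ultrafilter.of atTop
  have hFle : (F : Filter ℕ) ≤ atTop := Ultrafilter.of_le _
  have hmem : ∀ m, αs m ∈ {μ_1 : FiniteMeasure (Z × Z) |
      μ_1.mass ≤ (μ Set.univ).toNNReal ∧ ∀ n, μ_1 (K1 n ×ˢ K2 n)ᶜ ≤ u n} := by
    intro m
    refine ⟨?_, fun n => ?_⟩
    · rw [← ENNReal.coe_le_coe, FiniteMeasure.ennreal_mass, ENNReal.coe_toNNReal (measure_ne_top _ _)]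
      exact hβu m
    · rw [← ENNReal.coe_le_coe, FiniteMeasure.ennreal_coeFn_eq_coeFn_toMeasure]
      change β m _ ≤ ENNReal.ofReal (δ n + δ n)
      rw [ENNReal.ofReal_add (hδ n).le (hδ n).le]
      have hsub : (K1 n ×ˢ K2 n)ᶜ ⊆ Prod.fst ⁻¹' (K1 n)ᶜ ∪ Prod.snd ⁻¹' (K2 n)ᶜ := by
        rintro ⟨a, b⟩ hab
        simp only [Set.mem_compl_iff, Set.mem_prod, not_and_or] at hab
        exact hab
      refine (measure_mono hsub).trans ((measure_union_le _ _).trans (add_le_add ?_ ?_))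
      · rw [← Measure.map_apply measurable_fst (hK1 n).measurableSet.compl]
        exact (hβ1 m _).trans (hK1' n)
      · rw [← Measure.map_apply measurable_snd (hK2 n).measurableSet.compl]
        exact (hβ2 m _).trans (hK2' n)
  obtain ⟨α, -, hα⟩ := hcomp.ultrafilter_le_nhds (F.map αs) (by
    rw [Filter.le_principal_iff]
    exact Ultrafilter.mem_map.2 (Filter.univ_mem' hmem))
  have hlim : Tendsto αs (F : Filter ℕ) (𝓝 α) := hα
  have hmass : Tendsto (fun i => β i Set.univ) F (𝓝 ((α : Measure (Z × Z)) Set.univ)) := by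
    have := (FiniteMeasure.continuous_mass.tendsto α).comp hlim
    have := ENNReal.tendsto_coe.2 this
    simp only [FiniteMeasure.ennreal_mass, Function.comp_def] at this
    exact this
  have hmarg : ∀ (ρ : Measure Z) [IsFiniteMeasure ρ] (g : Z × Z → Z), Continuous g →
      (∀ n, (β n).map g ≤ ρ) → (α : Measure (Z × Z)).map g ≤ ρ := by
    intro ρ _ g hg hle
    rw [Measure.le_iff]
    intro s hs
    rw [s.measure_eq_iInf_isOpen ρ]
    refine le_iInf fun U => le_iInf fun hsU => le_iInf fun hU => ?_
    refine (measure_mono hsU).trans ?_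
    rw [Measure.map_apply hg.measurable hU.measurableSet]
    refine limit_open hlim (hU.preimage hg) _ (Filter.Eventually.of_forall fun n => ?_)
    have := hle n U
    rwa [Measure.map_apply hg.measurable hU.measurableSet] at this
  refine ⟨α, inferInstance, hmarg μ _ continuous_fst hβ1, hmarg ν _ continuous_snd hβ2, ?_, ?_⟩
  · have hU : {p : Z × Z | ε < dist p.1 p.2} =
        ⋃ m : ℕ, {p : Z × Z | ε + 5 * δ m < dist p.1 p.2} := by
      ext p
      simp only [Set.mem_iUnion, Set.mem_ofPred_eq]
      constructor
      · intro hp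
        have : Tendsto (fun m => ε + 5 * δ m) atTop (𝓝 (ε + 5 * 0)) :=
          tendsto_const_nhds.add (hδl.const_mul 5)
        rw [mul_zero, add_zero] at this
        exact (this.eventually (gt_mem_nhds hp)).exists
      · rintro ⟨m, hm⟩
        have := hδ m
        linarith
    rw [hU, measure_iUnion_null_iff]
    intro m
    rw [← nonpos_iff_eq_zero]
    refine limit_open hlim (isOpen_lt continuous_const continuous_dist) _ (hFle ?_)
    filter_upwards [hδl.eventually (gt_mem_nhds (hδ m))] with n hn
    rw [← hβ3 n]
    refine measure_mono fun p hp => ?_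
    simp only [Set.mem_ofPred_eq] at hp ⊢
    linarith
  · have h2 : Tendsto (fun n => ENNReal.ofReal (ε + 3 * δ n)) F (𝓝 (ENNReal.ofReal ε)) := by
      have : Tendsto (fun m => ε + 3 * δ m) atTop (𝓝 (ε + 3 * 0)) :=
        tendsto_const_nhds.add (hδl.const_mul 3)
      rw [mul_zero, add_zero] at this
      exact (ENNReal.tendsto_ofReal this).mono_left hFle
    exact ge_of_tendsto' (hmass.add h2) hβ4

lemma tvDist_le_of_le {Z : Type*} [MeasurableSpace Z] (μ ν : Measure Z) [IsFiniteMeasure ν]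
    (h : μ ≤ ν) : tvDist μ ν ≤ (ν Set.univ).toReal - (μ Set.univ).toReal := by
  have : IsFiniteMeasure μ := isFiniteMeasure_of_le ν h
  unfold tvDist
  refine csSup_le ⟨_, ∅, MeasurableSet.empty, rfl⟩ ?_
  rintro x ⟨A, hA, rfl⟩
  have h1 := ENNReal.toReal_mono (measure_ne_top _ _) (h A)
  have h2 := ENNReal.toReal_mono (measure_ne_top _ _) (h Aᶜ)
  rw [← measure_add_measure_compl hA, ← measure_add_measure_compl (μ := μ) hA,
    ENNReal.toReal_add (measure_ne_top _ _) (measure_ne_top _ _),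
    ENNReal.toReal_add (measure_ne_top _ _) (measure_ne_top _ _), abs_sub_comm, abs_of_nonneg
    (by linarith)]
  linarith

lemma abs_le_tvDist {Z : Type*} [MeasurableSpace Z] (μ ν : Measure Z) [IsFiniteMeasure μ]
    [IsFiniteMeasure ν] (A : Set Z) (hA : MeasurableSet A) :
    |(μ A).toReal - (ν A).toReal| ≤ tvDist μ ν := by
  unfold tvDist
  refine le_csSup ?_ ⟨A, hA, rfl⟩
  refine ⟨(μ Set.univ).toReal + (ν Set.univ).toReal, ?_⟩
  rintro x ⟨B, hB, rfl⟩
  have h1 := ENNReal.toReal_mono (measure_ne_top _ _) (measure_mono (μ := μ) (Set.subset_univ B))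
  have h2 := ENNReal.toReal_mono (measure_ne_top _ _) (measure_mono (μ := ν) (Set.subset_univ B))
  have h3 : 0 ≤ (μ B).toReal := ENNReal.toReal_nonneg
  have h4 : 0 ≤ (ν B).toReal := ENNReal.toReal_nonneg
  rw [abs_le]
  constructor <;> linarith

lemma exists_alpha_of_le {Z : Type*} [MetricSpace Z] [CompleteSpace Z]
    [TopologicalSpace.SeparableSpace Z] [MeasurableSpace Z] [BorelSpace Z]
    (μ ν : Measure Z) [IsFiniteMeasure μ] [IsFiniteMeasure ν] (ε : ℝ) (hε : 0 ≤ ε)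
    (hle : ν Set.univ ≤ μ Set.univ)
    (h : ∀ A : Set Z, IsClosed A → μ A ≤ ν (Metric.cthickening ε A) + ENNReal.ofReal ε) :
    ∃ α : Measure (Z × Z), IsFiniteMeasure α ∧
        discrepancy α μ ν + (α {p : Z × Z | ε < dist p.1 p.2}).toReal ≤ ε := by
  obtain ⟨β, hβf, hβ1, hβ2, hβ3, hβ4⟩ := strassen_sub μ ν ε hε h
  have hm1 : β.map Prod.fst Set.univ = β Set.univ := by
    rw [Measure.map_apply measurable_fst MeasurableSet.univ, Set.preimage_univ]
  have hm2 : β.map Prod.snd Set.univ = β Set.univ := by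
    rw [Measure.map_apply measurable_snd MeasurableSet.univ, Set.preimage_univ]
  have hβν : β Set.univ ≤ ν Set.univ := hm2 ▸ hβ2 Set.univ
  have hβ4' : (μ Set.univ).toReal ≤ (β Set.univ).toReal + ε := by
    have := ENNReal.toReal_mono (by finiteness) hβ4
    rwa [ENNReal.toReal_add (measure_ne_top _ _) ENNReal.ofReal_ne_top,
      ENNReal.toReal_ofReal hε] at this
  let μ' := μ - β.map Prod.fst
  let ν' := ν - β.map Prod.snd
  have hμ' : μ' + β.map Prod.fst = μ := Measure.sub_add_cancel_of_le hβ1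
  have hν' : ν' + β.map Prod.snd = ν := Measure.sub_add_cancel_of_le hβ2
  have hμf : IsFiniteMeasure μ' := isFiniteMeasure_of_le μ Measure.sub_le
  have hνf : IsFiniteMeasure ν' := isFiniteMeasure_of_le ν Measure.sub_le
  have hμu : μ' Set.univ + β Set.univ = μ Set.univ := by
    rw [← hm1, ← Measure.add_apply, hμ']
  have hνu : ν' Set.univ + β Set.univ = ν Set.univ := by
    rw [← hm2, ← Measure.add_apply, hν']
  have hμν : ν' Set.univ ≤ μ' Set.univ := by
    rw [← hμu, ← hνu] at hle
    exact (ENNReal.add_le_add_iff_right (measure_ne_top _ _)).1 hle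
  let γ : Measure (Z × Z) := (μ' Set.univ)⁻¹ • μ'.prod ν'
  have hγ2 : γ.map Prod.snd = ν' := by
    simp only [γ]
    rw [Measure.map_smul, Measure.map_snd_prod, smul_smul]
    by_cases h0 : μ' Set.univ = 0
    · have : ν' = 0 := by
        rw [← Measure.measure_univ_eq_zero]
        exact le_antisymm (hμν.trans h0.le) (zero_le)
      rw [this, smul_zero]
    · rw [ENNReal.inv_mul_cancel h0 (measure_ne_top _ _), one_smul]
  have hγ1 : γ.map Prod.fst ≤ μ' := by
    simp only [γ]
    rw [Measure.map_smul, Measure.map_fst_prod, smul_smul]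
    rw [Measure.le_iff]
    intro s _
    rw [Measure.smul_apply, smul_eq_mul]
    calc _ ≤ 1 * μ' s := by
          gcongr
          rw [mul_comm, ← div_eq_mul_inv]
          exact ENNReal.div_le_of_le_mul (by rwa [one_mul])
      _ = _ := one_mul _
  have hγu : γ Set.univ = ν' Set.univ := by
    rw [← hγ2, Measure.map_apply measurable_snd MeasurableSet.univ, Set.preimage_univ]
  have hγf : IsFiniteMeasure γ := ⟨by rw [hγu]; exact measure_lt_top _ _⟩
  have hf1 : (β + γ).map Prod.fst ≤ μ := by
    rw [Measure.map_add _ _ measurable_fst, ← hμ', add_comm]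
    exact add_le_add_left hγ1 _
  have hf2 : (β + γ).map Prod.snd = ν := by
    rw [Measure.map_add _ _ measurable_snd, hγ2, add_comm, hν']
  refine ⟨β + γ, inferInstance, ?_⟩
  have e1 := tvDist_le_of_le _ _ hf1
  have e2 := tvDist_le_of_le _ _ hf2.le
  rw [hf2, sub_self] at e2
  rw [Measure.map_apply measurable_fst MeasurableSet.univ, Set.preimage_univ, Measure.add_apply,
    hγu, ENNReal.toReal_add (measure_ne_top _ _) (measure_ne_top _ _)] at e1
  have e3 : ((β + γ) {p : Z × Z | ε < dist p.1 p.2}).toReal ≤ (ν' Set.univ).toReal := by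
    apply ENNReal.toReal_mono (measure_ne_top _ _)
    rw [Measure.add_apply, hβ3, zero_add, ← hγu]
    exact measure_mono (Set.subset_univ _)
  unfold discrepancy
  rw [hf2]
  linarith

lemma condition_of_le {Z : Type*} [MetricSpace Z] [MeasurableSpace Z] [BorelSpace Z]
    (μ ν : Measure Z) [IsFiniteMeasure μ] [IsFiniteMeasure ν] (ε : ℝ) (hε : 0 ≤ ε)
    (h : prokhorovDist μ ν ≤ ε) (A : Set Z) (hA : IsClosed A) :
    μ A ≤ ν (Metric.cthickening ε A) + ENNReal.ofReal ε ∧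
    ν A ≤ μ (Metric.cthickening ε A) + ENNReal.ofReal ε := by
  have hall : ∀ δ, ε < δ → μ A ≤ ν (Metric.cthickening δ A) + ENNReal.ofReal δ ∧
      ν A ≤ μ (Metric.cthickening δ A) + ENNReal.ofReal δ := by
    intro δ hδ
    obtain ⟨s, ⟨hs0, hs⟩, hsδ⟩ := exists_lt_of_csInf_lt (by
      refine ⟨(μ Set.univ).toReal + (ν Set.univ).toReal + 1, by positivity, fun B _ => ?_⟩
      have : ∀ (ρ : Measure Z) [IsFiniteMeasure ρ], (ρ Set.univ).toReal ≤
          (μ Set.univ).toReal + (ν Set.univ).toReal + 1 → ρ B ≤ ENNReal.ofReal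
            ((μ Set.univ).toReal + (ν Set.univ).toReal + 1) := by
        intro ρ _ hρ
        refine (measure_mono (Set.subset_univ B)).trans ?_
        rw [← ENNReal.ofReal_toReal (measure_ne_top ρ Set.univ)]
        exact ENNReal.ofReal_le_ofReal hρ
      have h1 : 0 ≤ (μ Set.univ).toReal := ENNReal.toReal_nonneg
      have h2 : 0 ≤ (ν Set.univ).toReal := ENNReal.toReal_nonneg
      exact ⟨(this μ (by linarith)).trans le_add_self, (this ν (by linarith)).trans le_add_self⟩)
      (h.trans_lt hδ)
    obtain ⟨h1, h2⟩ := hs A hA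
    have hsub := Metric.cthickening_mono hsδ.le A
    exact ⟨h1.trans (by gcongr), h2.trans (by gcongr)⟩
  have hlim : ∀ (ρ : Measure Z) [IsFiniteMeasure ρ] (c : ENNReal),
      (∀ δ, ε < δ → c ≤ ρ (Metric.cthickening δ A) + ENNReal.ofReal δ) →
      c ≤ ρ (Metric.cthickening ε A) + ENNReal.ofReal ε := by
    intro ρ _ c hc
    have h1 : Tendsto (fun δ => ρ (Metric.cthickening δ A)) (𝓝[>] ε)
        (𝓝 (ρ (Metric.cthickening ε A))) := by
      rw [Metric.cthickening_eq_iInter_cthickening A]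
      exact tendsto_measure_biInter_gt
        (fun r _ => Metric.isClosed_cthickening.measurableSet.nullMeasurableSet)
        (fun i j _ hij => Metric.cthickening_mono hij A)
        ⟨ε + 1, by linarith, measure_ne_top _ _⟩
    have h2 : Tendsto (fun δ => ENNReal.ofReal δ) (𝓝[>] ε) (𝓝 (ENNReal.ofReal ε)) :=
      (ENNReal.continuous_ofReal.tendsto ε).mono_left nhdsWithin_le_nhds
    refine ge_of_tendsto (h1.add h2) ?_
    filter_upwards [self_mem_nhdsWithin] with δ hδ using hc δ hδ
  exact ⟨hlim ν _ fun δ hδ => (hall δ hδ).1, hlim μ _ fun δ hδ => (hall δ hδ).2⟩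

lemma map_swap_discrepancy {Z : Type*} [MeasurableSpace Z]
    (α : Measure (Z × Z)) (μ ν : Measure Z) :
    discrepancy (α.map Prod.swap) μ ν = discrepancy α ν μ := by
  unfold discrepancy
  rw [Measure.map_map measurable_fst measurable_swap, Measure.map_map measurable_snd measurable_swap]
  rw [add_comm]
  rfl

lemma bound_of_alpha {Z : Type*} [MetricSpace Z] [TopologicalSpace.SeparableSpace Z]
    [MeasurableSpace Z] [BorelSpace Z]
    (μ ν : Measure Z) [IsFiniteMeasure μ] [IsFiniteMeasure ν] (ε : ℝ) (hε : 0 ≤ ε)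
    (α : Measure (Z × Z)) [IsFiniteMeasure α]
    (h : discrepancy α μ ν + (α {p : Z × Z | ε < dist p.1 p.2}).toReal ≤ ε)
    (δ : ℝ) (hδ : ε ≤ δ) (A : Set Z) (hA : IsClosed A) :
    μ A ≤ ν (Metric.cthickening δ A) + ENNReal.ofReal δ := by
  have hT : IsClosed (Metric.cthickening δ A) := Metric.isClosed_cthickening
  have e1 := abs_le_tvDist (α.map Prod.fst) μ A hA.measurableSet
  have e2 := abs_le_tvDist (α.map Prod.snd) ν _ hT.measurableSet
  rw [Measure.map_apply measurable_fst hA.measurableSet] at e1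
  rw [Measure.map_apply measurable_snd hT.measurableSet] at e2
  have e3 : α (Prod.fst ⁻¹' A) ≤ α (Prod.snd ⁻¹' (Metric.cthickening δ A)) +
      α {p : Z × Z | ε < dist p.1 p.2} := by
    refine (measure_mono ?_).trans (measure_union_le _ _)
    intro p hp
    by_cases hd : ε < dist p.1 p.2
    · right; exact hd
    · left
      exact Metric.mem_cthickening_of_dist_le p.2 p.1 δ A hp
        (by rw [dist_comm]; exact (not_lt.1 hd).trans hδ)
  have e4 := ENNReal.toReal_mono (by finiteness) e3
  rw [ENNReal.toReal_add (measure_ne_top _ _) (measure_ne_top _ _)] at e4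
  unfold discrepancy at h
  rw [abs_le] at e1 e2
  rw [← ENNReal.ofReal_toReal (measure_ne_top μ A),
    ← ENNReal.ofReal_toReal (measure_ne_top ν (Metric.cthickening δ A)),
    ← ENNReal.ofReal_add ENNReal.toReal_nonneg (hε.trans hδ)]
  apply ENNReal.ofReal_le_ofReal
  linarith [e1.1, e2.2]

lemma swap_set {Z : Type*} [MetricSpace Z] [TopologicalSpace.SeparableSpace Z]
    [MeasurableSpace Z] [BorelSpace Z] (α : Measure (Z × Z)) (ε : ℝ) :
    (α.map Prod.swap) {p : Z × Z | ε < dist p.1 p.2} = α {p : Z × Z | ε < dist p.1 p.2} := by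
  have : SecondCountableTopology Z := UniformSpace.secondCountable_of_separable Z
  rw [Measure.map_apply measurable_swap (isOpen_lt continuous_const continuous_dist).measurableSet]
  congr 1
  ext p
  simp [dist_comm]

lemma strassen_iff {Z : Type*} [MetricSpace Z] [CompleteSpace Z]
    [TopologicalSpace.SeparableSpace Z] [MeasurableSpace Z] [BorelSpace Z]
    (μ ν : Measure Z) [IsFiniteMeasure μ] [IsFiniteMeasure ν] (ε : ℝ) (hε : 0 ≤ ε) :
    prokhorovDist μ ν ≤ ε ↔ ∃ α : Measure (Z × Z), IsFiniteMeasure α ∧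
        discrepancy α μ ν + (α {p : Z × Z | ε < dist p.1 p.2}).toReal ≤ ε := by
  constructor
  · intro h
    have hc := condition_of_le μ ν ε hε h
    rcases le_total (ν Set.univ) (μ Set.univ) with hle | hle
    · exact exists_alpha_of_le μ ν ε hε hle fun A hA => (hc A hA).1
    · obtain ⟨α, hα, hα'⟩ := exists_alpha_of_le ν μ ε hε hle fun A hA => (hc A hA).2
      exact ⟨α.map Prod.swap, inferInstance, by rwa [map_swap_discrepancy, swap_set]⟩
  · rintro ⟨α, hα, h⟩
    apply le_of_forall_gt_imp_ge_of_dense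
    intro δ hδ
    refine csInf_le ⟨0, fun x hx => hx.1.le⟩ ⟨hε.trans_lt hδ, fun A hA => ⟨?_, ?_⟩⟩
    · exact bound_of_alpha μ ν ε hε α h δ hδ.le A hA
    · exact bound_of_alpha ν μ ε hε (α.map Prod.swap)
        (by rwa [map_swap_discrepancy, swap_set]) δ hδ.le A hA

/-- **Generalized Strassen theorem.** The Prokhorov distance of two finite Borel measures
on a complete separable metric space `Z` is the least `ε ≥ 0` for which there exists a finite
Borel measure `α` on `Z × Z` with
`D(α; μ, ν) + α {(x,y) | d(x,y) > ε} ≤ ε`; in particular, for every `ε ≥ 0`,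
`dP(μ,ν) ≤ ε` iff such an `α` exists. -/
theorem generalized_strassen {Z : Type*} [MetricSpace Z] [CompleteSpace Z]
    [TopologicalSpace.SeparableSpace Z] [MeasurableSpace Z] [BorelSpace Z]
    (μ ν : Measure Z) [IsFiniteMeasure μ] [IsFiniteMeasure ν] :
    IsLeast {ε : ℝ | 0 ≤ ε ∧ ∃ α : Measure (Z × Z), IsFiniteMeasure α ∧
        discrepancy α μ ν + (α {p : Z × Z | ε < dist p.1 p.2}).toReal ≤ ε}
      (prokhorovDist μ ν) ∧
    ∀ ε : ℝ, 0 ≤ ε →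
      (prokhorovDist μ ν ≤ ε ↔ ∃ α : Measure (Z × Z), IsFiniteMeasure α ∧
        discrepancy α μ ν + (α {p : Z × Z | ε < dist p.1 p.2}).toReal ≤ ε) := by
  have h0 : 0 ≤ prokhorovDist μ ν := Real.sInf_nonneg fun x hx => hx.1.le
  refine ⟨⟨⟨h0, (strassen_iff μ ν _ h0).1 le_rfl⟩, ?_⟩, fun ε hε => strassen_iff μ ν ε hε⟩
  rintro ε ⟨hε, hα⟩
  exact (strassen_iff μ ν ε hε).2 hα

end
end

section
/- Let μ and ν be finite Borel measures on a complete separable metric space Z with μ(Z) ≤ ν(Z), and let ε := dP(μ,ν). Then there exists a finite Borel measure α on Z × Z such that π₁_*α = μ, π₂_*α ≤ ν, α is supported on supp(μ) × supp(ν), and D(α;μ,ν) + α({(x,y) ∈ Z × Z : d(x,y) > ε}) ≤ ε. -/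
open MeasureTheory Topology Filter

noncomputable section

/-- The (topological) support of a measure. -/
def measSupport {Z : Type*} [TopologicalSpace Z] [MeasurableSpace Z] (μ : Measure Z) : Set Z :=
  {x | ∀ U : Set Z, IsOpen U → x ∈ U → 0 < μ U}


open Classical in
lemma fracHallNat {I J : Type} [Fintype I] [Fintype J] (a : I → ℕ) (b : J → ℕ)
    (r : I → J → Prop)
    (h : ∀ S : Finset I, ∑ i ∈ S, a i ≤ ∑ j with ∃ i ∈ S, r i j, b j) :
    ∃ w : I → J → ℕ, (∀ i j, ¬ r i j → w i j = 0) ∧ (∀ i, ∑ j, w i j = a i) ∧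
      ∀ j, ∑ i, w i j ≤ b j := by
  let t : (Σ i, Fin (a i)) → Finset (Σ j, Fin (b j)) := fun x =>
    Finset.univ.filter (fun y => r x.1 y.1)
  have key : ∀ s : Finset (Σ i, Fin (a i)), s.card ≤ (s.biUnion t).card := by
    intro s
    let S : Finset I := s.image Sigma.fst
    have h1 : s ⊆ S.sigma (fun i => (Finset.univ : Finset (Fin (a i)))) := by
      intro x hx
      simp only [Finset.mem_sigma, Finset.mem_univ, and_true]
      exact Finset.mem_image_of_mem _ hx
    have h2 : (Finset.univ.filter (fun j => ∃ i ∈ S, r i j)).sigma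
        (fun j => (Finset.univ : Finset (Fin (b j)))) ⊆ s.biUnion t := by
      intro y hy
      simp only [Finset.mem_sigma, Finset.mem_univ, and_true, Finset.mem_filter, true_and] at hy
      obtain ⟨i, hi, hr⟩ := hy
      obtain ⟨x, hx, rfl⟩ := Finset.mem_image.1 hi
      exact Finset.mem_biUnion.2 ⟨x, hx, by simp [t, hr]⟩
    have h3 := Finset.card_le_card h1
    have h4 := Finset.card_le_card h2
    simp only [Finset.card_sigma, Finset.card_univ, Fintype.card_fin] at h3 h4
    exact h3.trans ((h S).trans h4)
  obtain ⟨f, hf, hft⟩ := (Finset.all_card_le_biUnion_card_iff_exists_injective t).1 key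
  have hft' : ∀ x, r x.1 (f x).1 := fun x => by simpa [t] using hft x
  refine ⟨fun i j => (Finset.univ.filter (fun k : Fin (a i) => (f ⟨i, k⟩).1 = j)).card, ?_, ?_, ?_⟩
  · intro i j hr
    rw [Finset.card_eq_zero, Finset.filter_eq_empty_iff]
    intro k _ hk
    exact hr (hk ▸ hft' ⟨i, k⟩)
  · intro i
    have := Finset.card_eq_sum_card_fiberwise (s := (Finset.univ : Finset (Fin (a i))))
      (f := fun k => (f ⟨i, k⟩).1) (t := Finset.univ)
      (fun _ _ => Finset.mem_coe.2 (Finset.mem_univ _))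
    rw [Finset.card_univ, Fintype.card_fin] at this
    exact this.symm
  · intro j
    rw [← Finset.card_sigma]
    rw [← Fintype.card_fin (b j), ← Finset.card_univ,
      ← Finset.card_map (Function.Embedding.sigmaMk (β := fun j => Fin (b j)) j)]
    refine Finset.card_le_card_of_injOn f ?_ (hf.injOn)
    intro x hx
    simp only [Finset.coe_sigma, Finset.coe_filter, Set.mem_sigma_iff, Finset.mem_univ, true_and, Set.mem_ofPred_eq, Finset.coe_univ, Set.mem_univ] at hx
    simp only [Finset.coe_map, Finset.coe_univ, Set.image_univ, Set.mem_range]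
    subst hx
    exact ⟨(f x).2, rfl⟩

open Classical in
lemma fracHallReal {I J : Type} [Fintype I] [Fintype J] (a : I → ℝ) (b : J → ℝ)
    (ha : ∀ i, 0 ≤ a i) (hb : ∀ j, 0 ≤ b j)
    (r : I → J → Prop)
    (h : ∀ S : Finset I, ∑ i ∈ S, a i ≤ ∑ j with ∃ i ∈ S, r i j, b j) :
    ∃ w : I → J → ℝ, (∀ i j, 0 ≤ w i j) ∧ (∀ i j, ¬ r i j → w i j = 0) ∧
      (∀ i, ∑ j, w i j = a i) ∧ ∀ j, ∑ i, w i j ≤ b j := by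
  have step : ∀ n : ℕ, ∃ w : I → J → ℕ, (∀ i j, ¬ r i j → w i j = 0) ∧
      (∀ i, ∑ j, w i j = ⌊a i * n⌋₊) ∧ ∀ j, ∑ i, w i j ≤ ⌈b j * n⌉₊ := by
    intro n
    apply fracHallNat
    intro S
    have : ((∑ i ∈ S, ⌊a i * n⌋₊ : ℕ) : ℝ) ≤
        ((∑ j with ∃ i ∈ S, r i j, ⌈b j * n⌉₊ : ℕ) : ℝ) := by
      push_cast
      calc ∑ i ∈ S, (⌊a i * n⌋₊ : ℝ) ≤ ∑ i ∈ S, a i * n :=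
            Finset.sum_le_sum fun i _ => Nat.floor_le (mul_nonneg (ha i) n.cast_nonneg)
        _ ≤ ∑ j with ∃ i ∈ S, r i j, b j * n := by
            rw [← Finset.sum_mul, ← Finset.sum_mul]
            exact mul_le_mul_of_nonneg_right (h S) n.cast_nonneg
        _ ≤ _ := Finset.sum_le_sum fun j _ => Nat.le_ceil _
    exact_mod_cast this
  choose w hw0 hwa hwb using step
  let v : ℕ → (I → J → ℝ) := fun n i j => (w n i j : ℝ) / n
  have hva : ∀ n i, ∑ j, v n i j = (⌊a i * n⌋₊ : ℝ) / n := by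
    intro n i
    simp only [v]
    rw [← Finset.sum_div, ← hwa n i]; push_cast; rfl
  have hvb : ∀ n j, ∑ i, v n i j ≤ (⌈b j * n⌉₊ : ℝ) / n := by
    intro n j
    simp only [v]
    rw [← Finset.sum_div]
    gcongr
    exact_mod_cast hwb n j
  have hv0 : ∀ n i j, 0 ≤ v n i j := fun n i j => by positivity
  have hbd : ∀ n i j, v n i j ≤ a i := by
    intro n i j
    refine (Finset.single_le_sum (f := fun j => v n i j) (fun j _ => hv0 n i j) (Finset.mem_univ j)).trans ?_
    rw [hva]
    rcases n.eq_zero_or_pos with rfl | hn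
    · simpa using ha i
    · rw [div_le_iff₀ (by positivity)]
      exact Nat.floor_le (mul_nonneg (ha i) n.cast_nonneg)
  have hcomp : IsCompact (Set.Icc (0 : I → J → ℝ) (fun i _ => a i)) := isCompact_Icc
  obtain ⟨x, hx, φ, hφ, hlim⟩ := hcomp.tendsto_subseq (x := v)
    (fun n => ⟨fun i j => hv0 n i j, fun i j => hbd n i j⟩)
  have hij : ∀ i j, Tendsto (fun n => v (φ n) i j) atTop (𝓝 (x i j)) := fun i j =>
    (tendsto_pi_nhds.1 ((tendsto_pi_nhds.1 hlim) i) j)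
  have hcast : Tendsto (fun n => ((φ n : ℕ) : ℝ)) atTop atTop :=
    tendsto_natCast_atTop_atTop.comp hφ.tendsto_atTop
  refine ⟨x, fun i j => hx.1 i j, ?_, ?_, ?_⟩
  · intro i j hr
    refine tendsto_nhds_unique (hij i j) ?_
    simp [v, hw0 _ i j hr]
  · intro i
    refine tendsto_nhds_unique (tendsto_finsetSum _ fun j _ => hij i j) ?_
    simp only [hva]
    exact (tendsto_nat_floor_mul_div_atTop (ha i)).comp hcast
  · intro j
    refine le_of_tendsto_of_tendsto' (tendsto_finsetSum _ fun i _ => hij i j)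
      ((tendsto_nat_ceil_mul_div_atTop (hb j)).comp hcast) fun n => ?_
    exact hvb _ j

open Classical in
lemma fracHallDelta {I J : Type} [Fintype I] [Fintype J] (a : I → ℝ) (b : J → ℝ)
    (ha : ∀ i, 0 ≤ a i) (hb : ∀ j, 0 ≤ b j) (δ : ℝ) (hδ : 0 ≤ δ)
    (r : I → J → Prop)
    (h : ∀ S : Finset I, ∑ i ∈ S, a i ≤ ∑ j with ∃ i ∈ S, r i j, b j + δ) :
    ∃ w : I → J → ℝ, (∀ i j, 0 ≤ w i j) ∧ (∀ i j, ¬ r i j → w i j = 0) ∧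
      (∀ i, ∑ j, w i j ≤ a i) ∧ (∀ j, ∑ i, w i j ≤ b j) ∧ ∑ i, a i ≤ ∑ i, ∑ j, w i j + δ := by
  obtain ⟨w, hw0, hwr, hwa, hwb⟩ := fracHallReal (J := Option J) a (fun o => o.elim δ b) ha
    (by rintro (_ | j); exacts [hδ, hb j]) (fun i o => o.elim True (r i)) (by
      intro S
      rcases S.eq_empty_or_nonempty with rfl | hS
      · simp
      · refine (h S).trans (le_of_eq ?_)
        rw [Finset.sum_filter, Finset.sum_filter, Fintype.sum_option]
        have : ∃ i, i ∈ S := hS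
        simp only [this, Option.elim, and_true, if_true]
        rw [add_comm]
        congr)
  refine ⟨fun i j => w i (some j), fun i j => hw0 _ _, fun i j hr => hwr _ _ hr, ?_, ?_, ?_⟩
  · intro i
    rw [← hwa i, Fintype.sum_option]
    linarith [hw0 i none]
  · intro j; exact hwb (some j)
  · simp only [← hwa, Fintype.sum_option, Finset.sum_add_distrib]
    have := hwb none
    simp only [Option.elim] at this
    linarith


lemma open_le_of_tendsto {Ω ι : Type*} {L : Filter ι} [L.NeBot]
    [MeasurableSpace Ω] [TopologicalSpace Ω] [HasOuterApproxClosed Ω]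
    [OpensMeasurableSpace Ω] {μ : FiniteMeasure Ω}
    {μs : ι → FiniteMeasure Ω} (hlim : Tendsto μs L (𝓝 μ)) {G : Set Ω} (hG : IsOpen G)
    (c : ENNReal) (hc : c ≠ ⊤) (h : ∀ᶠ i in L, (μs i : Measure Ω) G ≤ c) : (μ : Measure Ω) G ≤ c := by
  have hF := FiniteMeasure.limsup_measure_closed_le_of_tendsto hlim hG.isClosed_compl
  have hmass : Tendsto (fun i => (μs i : Measure Ω) Set.univ - c) L
      (𝓝 ((μ : Measure Ω) Set.univ - c)) := by
    refine ENNReal.Tendsto.sub ?_ tendsto_const_nhds (Or.inr hc)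
    have := (ENNReal.continuous_coe.tendsto _).comp ((FiniteMeasure.continuous_mass.tendsto μ).comp hlim)
    simpa [Function.comp_def] using this
  have h1 : (μ : Measure Ω) Set.univ - c ≤ (μ : Measure Ω) Gᶜ := by
    rw [← hmass.limsup_eq]
    refine le_trans (limsup_le_limsup ?_) hF
    filter_upwards [h] with i hi
    rw [measure_compl hG.measurableSet (measure_ne_top _ _)]
    exact tsub_le_tsub_left hi _
  have h2 := measure_add_measure_compl (μ := (μ : Measure Ω)) hG.measurableSet
  rw [tsub_le_iff_right, ← h2, add_comm] at h1
  exact (ENNReal.add_le_add_iff_left (measure_ne_top _ _)).1 h1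

lemma le_of_tendsto_measure {Z ι : Type*} {L : Filter ι} [L.NeBot] [MetricSpace Z]
    [MeasurableSpace Z] [BorelSpace Z] (μ : Measure Z) [IsFiniteMeasure μ]
    {ρ : FiniteMeasure Z} {ρs : ι → FiniteMeasure Z} (hlim : Tendsto ρs L (𝓝 ρ))
    (h : ∀ i, (ρs i : Measure Z) ≤ μ) : (ρ : Measure Z) ≤ μ := by
  rw [Measure.le_iff]
  intro s _
  rw [Set.measure_eq_iInf_isOpen s μ]
  refine le_iInf fun U => le_iInf fun hU => le_iInf fun hUo => ?_
  refine (measure_mono hU).trans ?_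
  exact open_le_of_tendsto hlim hUo _ (measure_ne_top _ _) (Eventually.of_forall fun i => h i U)

/-- limit of approximate subcouplings -/
lemma exists_limit {Z : Type*} [MetricSpace Z] [CompleteSpace Z]
    [TopologicalSpace.SeparableSpace Z] [MeasurableSpace Z] [BorelSpace Z]
    (μ ν : Measure Z) [IsFiniteMeasure μ] [IsFiniteMeasure ν] (ε : ℝ) (M : ENNReal)
    (H : ∀ η : ℝ, 0 < η → ∃ β : Measure (Z × Z), β.map Prod.fst ≤ μ ∧ β.map Prod.snd ≤ ν ∧
      β {p | ε + η < dist p.1 p.2} = 0 ∧ M ≤ β Set.univ + ENNReal.ofReal η) :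
    ∃ β : Measure (Z × Z), β.map Prod.fst ≤ μ ∧ β.map Prod.snd ≤ ν ∧
      β {p | ε < dist p.1 p.2} = 0 ∧ M ≤ β Set.univ := by
  obtain ⟨η, -, hηpos, hη0⟩ := exists_seq_strictAnti_tendsto (0 : ℝ)
  choose β hβ1 hβ2 hβd hβM using fun n => H (η n) (hηpos n)
  have hfst : ∀ n s, MeasurableSet s → β n (Prod.fst ⁻¹' s) ≤ μ s := fun n s hs => by
    rw [← Measure.map_apply measurable_fst hs]; exact hβ1 n s
  have hsnd : ∀ n s, MeasurableSet s → β n (Prod.snd ⁻¹' s) ≤ ν s := fun n s hs => by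
    rw [← Measure.map_apply measurable_snd hs]; exact hβ2 n s
  have hfin : ∀ n, IsFiniteMeasure (β n) := fun n =>
    ⟨(by simpa using hfst n _ MeasurableSet.univ : β n Set.univ ≤ μ Set.univ).trans_lt
      (measure_lt_top _ _)⟩
  let B : ℕ → FiniteMeasure (Z × Z) := fun n => ⟨β n, hfin n⟩
  obtain ⟨u, -, u_pos, u_lim⟩ :
      ∃ u : ℕ → NNReal, StrictAnti u ∧ (∀ n, 0 < u n) ∧ Tendsto u atTop (𝓝 0) :=
    exists_seq_strictAnti_tendsto (0 : NNReal)
  have hT := isTightMeasureSet_iff_exists_isCompact_measure_compl_le.1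
    (isTightMeasureSet_singleton (μ := μ + ν))
  choose K hK hKu using fun n => hT (u n) (by exact_mod_cast u_pos n)
  have hKm : ∀ n, MeasurableSet (K n) := fun n => (hK n).isClosed.measurableSet
  have hcomp := isCompact_setOfPred_finiteMeasure_mass_le_compl_isCompact_le
    (E := Z × Z) (u := u) (K := fun n => K n ×ˢ K n) (μ Set.univ).toNNReal u_lim
    (fun n => (hK n).prod (hK n)) (Or.inl inferInstance)
  have hBmem : ∀ n, B n ∈ {β : FiniteMeasure (Z × Z) | β.mass ≤ (μ Set.univ).toNNReal ∧
      ∀ n, β (K n ×ˢ K n)ᶜ ≤ u n} := by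
    intro n
    refine ⟨?_, fun k => ?_⟩
    · refine ENNReal.toNNReal_mono (measure_ne_top _ _) ?_
      change β n Set.univ ≤ _
      simpa using hfst n _ MeasurableSet.univ
    · rw [← ENNReal.coe_le_coe, FiniteMeasure.ennreal_coeFn_eq_coeFn_toMeasure]
      have hsub : (K k ×ˢ K k)ᶜ ⊆ Prod.fst ⁻¹' (K k)ᶜ ∪ Prod.snd ⁻¹' (K k)ᶜ := by
        rw [Set.compl_prod_eq_union]
        rintro p (hp | hp)
        · exact Or.inl hp.1
        · exact Or.inr hp.2
      calc β n (K k ×ˢ K k)ᶜ ≤ β n (Prod.fst ⁻¹' (K k)ᶜ) + β n (Prod.snd ⁻¹' (K k)ᶜ) :=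
            (measure_mono hsub).trans (measure_union_le _ _)
        _ ≤ μ (K k)ᶜ + ν (K k)ᶜ := add_le_add (hfst n _ (hKm k).compl) (hsnd n _ (hKm k).compl)
        _ ≤ u k := by simpa using hKu k _ rfl
  obtain ⟨b, -, hb⟩ := isCompact_iff_ultrafilter_le_nhds'.1 hcomp
    ((hyperfilter ℕ).map B)
    (Ultrafilter.mem_map.2 (Filter.univ_mem' hBmem))
  have hlim : Tendsto B (hyperfilter ℕ : Filter ℕ) (𝓝 b) := hb
  have hat : (hyperfilter ℕ : Filter ℕ) ≤ atTop := Nat.hyperfilter_le_atTop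
  refine ⟨b, ?_, ?_, ?_, ?_⟩
  · exact le_of_tendsto_measure μ
      (FiniteMeasure.tendsto_map_of_tendsto_of_continuous B b hlim continuous_fst) hβ1
  · exact le_of_tendsto_measure ν
      (FiniteMeasure.tendsto_map_of_tendsto_of_continuous B b hlim continuous_snd) hβ2
  · have hU : {p : Z × Z | ε < dist p.1 p.2} = ⋃ k, {p : Z × Z | ε + η k < dist p.1 p.2} := by
      ext p
      simp only [Set.mem_ofPred_eq, Set.mem_iUnion]
      constructor
      · intro hp
        obtain ⟨k, hk⟩ := (hη0.eventually (gt_mem_nhds (sub_pos.2 hp))).exists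
        exact ⟨k, by linarith⟩
      · rintro ⟨k, hk⟩
        linarith [hηpos k]
    rw [hU, measure_iUnion_null_iff]
    intro k
    have hopen : IsOpen {p : Z × Z | ε + η k < dist p.1 p.2} :=
      isOpen_lt continuous_const (continuous_fst.dist continuous_snd)
    refine le_antisymm (open_le_of_tendsto hlim hopen 0 ENNReal.zero_ne_top ?_) zero_le
    have : ∀ᶠ n in atTop, η n < η k := hη0.eventually (gt_mem_nhds (hηpos k))
    filter_upwards [hat this] with n hn
    rw [← hβd n]
    refine measure_mono (μ := β n) fun p hp => ?_
    simp only [Set.mem_ofPred_eq] at hp ⊢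
    linarith
  · have h1 : Tendsto (fun n => β n Set.univ) (hyperfilter ℕ : Filter ℕ) (𝓝 ((b : Measure (Z × Z)) Set.univ)) := by
      have := (ENNReal.continuous_coe.tendsto _).comp ((FiniteMeasure.continuous_mass.tendsto b).comp hlim)
      simp only [FiniteMeasure.ennreal_mass] at this
      refine this.congr fun n => ?_
      exact FiniteMeasure.ennreal_mass (μ := B n)
    have h2 : Tendsto (fun n => ENNReal.ofReal (η n)) (hyperfilter ℕ : Filter ℕ) (𝓝 0) := by
      have := (ENNReal.continuous_ofReal.tendsto 0).comp (hη0.mono_left hat)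
      simpa [Function.comp_def] using this
    have h3 := h1.add h2
    rw [add_zero] at h3
    exact ge_of_tendsto' h3 hβM

lemma exists_cells {Z : Type*} [MetricSpace Z]
    [TopologicalSpace.SeparableSpace Z] [MeasurableSpace Z] [BorelSpace Z] [Nonempty Z]
    (μ ν : Measure Z) [IsFiniteMeasure μ] [IsFiniteMeasure ν] (η : ℝ) (hη : 0 < η) :
    ∃ (N : ℕ) (P : Fin N → Set Z), (∀ i, MeasurableSet (P i)) ∧
      Pairwise (Function.onFun Disjoint P) ∧ (∀ i, ∀ x ∈ P i, ∀ y ∈ P i, dist x y < η) ∧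
      μ.real (⋃ i, P i)ᶜ ≤ η ∧ ν.real (⋃ i, P i)ᶜ ≤ η := by
  let b : ℕ → Set Z := fun n => Metric.ball (TopologicalSpace.denseSeq Z n) (η / 2)
  have hb : ∀ n, MeasurableSet (b n) := fun n => Metric.isOpen_ball.measurableSet
  let Q := disjointed b
  have hQm : ∀ n, MeasurableSet (Q n) := MeasurableSet.disjointed hb
  have hQd : Pairwise (Function.onFun Disjoint Q) := disjoint_disjointed b
  have hQb : ∀ n, Q n ⊆ b n := disjointed_subset b
  have hQU : ⋃ n, Q n = Set.univ := by
    rw [iUnion_disjointed, Set.eq_univ_iff_forall]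
    intro x
    obtain ⟨n, hn⟩ := (TopologicalSpace.denseRange_denseSeq Z).exists_dist_lt x (half_pos hη)
    exact Set.mem_iUnion.2 ⟨n, by simpa [b] using hn⟩
  have hsum : HasSum (fun n => (μ + ν) (Q n)) ((μ + ν) Set.univ) := by
    rw [← hQU, measure_iUnion hQd hQm]
    exact ENNReal.summable.hasSum
  have h1 := (hsum.tendsto_sum_nat).add_const (ENNReal.ofReal η)
  have hlt : (μ + ν) Set.univ < (μ + ν) Set.univ + ENNReal.ofReal η :=
    ENNReal.lt_add_right (measure_ne_top _ _) (by simpa using hη)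
  obtain ⟨N, hN⟩ := (h1.eventually (lt_mem_nhds hlt)).exists
  refine ⟨N, fun i => Q i, fun i => hQm i, fun i j hij => hQd (fun h => hij (Fin.ext h)), ?_, ?_⟩
  · intro i x hx y hy
    have h1 := hQb _ hx
    have h2 := hQb _ hy
    simp only [b, Metric.mem_ball] at h1 h2
    linarith [dist_triangle_right x y (TopologicalSpace.denseSeq Z i)]
  · have hmU : MeasurableSet (⋃ i : Fin N, Q i) := MeasurableSet.iUnion fun i => hQm i
    have hs : ∑ i ∈ Finset.range N, (μ + ν) (Q i) = (μ + ν) (⋃ i : Fin N, Q i) := by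
      have hd : Pairwise (Function.onFun Disjoint (fun i : Fin N => Q i)) :=
        fun i j hij => hQd (fun h => hij (Fin.ext h))
      rw [measure_iUnion hd (fun i => hQm i), tsum_fintype, Finset.sum_range]
    rw [hs, ← measure_add_measure_compl hmU] at hN
    have h2 := (ENNReal.add_lt_add_iff_left (measure_ne_top _ _)).1 hN
    rw [Measure.add_apply] at h2
    constructor
    · exact ENNReal.toReal_le_of_le_ofReal hη.le (le_self_add.trans h2.le)
    · exact ENNReal.toReal_le_of_le_ofReal hη.le (le_add_self.trans h2.le)

lemma approx_coupling {Z : Type*} [MetricSpace Z]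
    [TopologicalSpace.SeparableSpace Z] [MeasurableSpace Z] [BorelSpace Z]
    (μ ν : Measure Z) [IsFiniteMeasure μ] [IsFiniteMeasure ν] (ε δ : ℝ) (hδ : 0 ≤ δ)
    (h : ∀ e, ε < e → ∀ B : Set Z, IsClosed B →
      μ.real B ≤ ν.real (Metric.cthickening e B) + δ + (e - ε)) (hε : 0 ≤ ε)
    (η : ℝ) (hη : 0 < η) :
    ∃ β : Measure (Z × Z), β.map Prod.fst ≤ μ ∧ β.map Prod.snd ≤ ν ∧
      β {p | ε + η < dist p.1 p.2} = 0 ∧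
      μ Set.univ - ENNReal.ofReal δ ≤ β Set.univ + ENNReal.ofReal η := by
  classical
  rcases isEmpty_or_nonempty Z with hZ | hZ
  · refine ⟨0, by simp, by simp, by simp, ?_⟩
    simp [Set.univ_eq_empty_iff.2 hZ]
  obtain ⟨t, ht, rfl⟩ : ∃ t, 0 < t ∧ η = 4 * t := ⟨η / 4, by positivity, by ring⟩
  obtain ⟨N, P, hPm, hPd, hPdiam, hμP, hνP⟩ := exists_cells μ ν t ht
  let U := ⋃ i, P i
  let r : Fin N → Fin N → Prop := fun i j => ∃ x ∈ P i, ∃ y ∈ P j, dist x y < ε + 2 * t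
  obtain ⟨w, hw0, hwr, hwa, hwb, hwsum⟩ := fracHallDelta (fun i => μ.real (P i))
    (fun i => ν.real (P i)) (fun i => measureReal_nonneg) (fun i => measureReal_nonneg)
    (δ + 2 * t) (by positivity) r (by
      intro S
      have hsub : Metric.cthickening (ε + t) (closure (⋃ i ∈ S, P i)) ⊆
          (⋃ j ∈ Finset.univ.filter (fun j => ∃ i ∈ S, r i j), P j) ∪ Uᶜ := by
        intro y hy
        by_cases hyU : y ∈ U
        · left
          obtain ⟨j, hj⟩ := Set.mem_iUnion.1 hyU
          rw [Metric.cthickening_closure] at hy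
          have hy' := Metric.cthickening_subset_thickening' (δ₁ := ε + t) (δ₂ := ε + 2 * t)
            (by positivity) (by linarith) _ hy
          obtain ⟨x, hx, hxy⟩ := Metric.mem_thickening_iff.1 hy'
          simp only [Set.mem_iUnion] at hx
          obtain ⟨i, hi, hx⟩ := hx
          simp only [Set.mem_iUnion, Finset.mem_filter, Finset.mem_univ, true_and]
          exact ⟨j, ⟨i, hi, x, hx, y, hj, by rwa [dist_comm]⟩, hj⟩
        · exact Or.inr hyU
      rw [← measureReal_biUnion_finset (fun i _ j _ hij => hPd hij) (fun i _ => hPm i),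
        ← measureReal_biUnion_finset (fun i _ j _ hij => hPd hij) (fun i _ => hPm i)]
      calc μ.real (⋃ i ∈ S, P i) ≤ μ.real (closure (⋃ i ∈ S, P i)) :=
            measureReal_mono subset_closure
        _ ≤ _ := h (ε + t) (by linarith) _ isClosed_closure
        _ ≤ ν.real (⋃ j ∈ Finset.univ.filter (fun j => ∃ i ∈ S, r i j), P j) + ν.real Uᶜ
              + δ + (ε + t - ε) := by
            gcongr
            exact (measureReal_mono hsub).trans (measureReal_union_le _ _)
        _ ≤ ν.real (⋃ j ∈ Finset.univ.filter (fun j => ∃ i ∈ S, r i j), P j) + (δ + 2 * t) := by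
            have hνU : ν.real Uᶜ ≤ t := hνP
            linarith
        _ = _ := by congr!)
  have hwi : ∀ i j, w i j ≤ μ.real (P i) := fun i j =>
    (Finset.single_le_sum (f := fun j => w i j) (fun j _ => hw0 i j) (Finset.mem_univ j)).trans (hwa i)
  have hwj : ∀ i j, w i j ≤ ν.real (P j) := fun i j =>
    (Finset.single_le_sum (f := fun i => w i j) (fun i _ => hw0 i j) (Finset.mem_univ i)).trans (hwb j)
  have hμr : ∀ i, μ (P i) = ENNReal.ofReal (μ.real (P i)) := fun i => by simp
  have hνr : ∀ i, ν (P i) = ENNReal.ofReal (ν.real (P i)) := fun i => by simp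
  let c : Fin N → Fin N → ENNReal := fun i j =>
    ENNReal.ofReal (w i j / (μ.real (P i) * ν.real (P j)))
  have hcν : ∀ i j, c i j * ν (P j) ≤ ENNReal.ofReal (w i j / μ.real (P i)) := by
    intro i j
    rw [hνr, ← ENNReal.ofReal_mul (by have := hw0 i j; positivity)]
    apply ENNReal.ofReal_le_ofReal
    have h1 := hw0 i j
    rcases eq_or_ne (ν.real (P j)) 0 with h0 | h0
    · rw [h0]; simp; positivity
    · rw [← div_div, div_mul_cancel₀ _ h0]
  have hcμ : ∀ i j, c i j * μ (P i) ≤ ENNReal.ofReal (w i j / ν.real (P j)) := by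
    intro i j
    rw [hμr, ← ENNReal.ofReal_mul (by have := hw0 i j; positivity)]
    apply ENNReal.ofReal_le_ofReal
    have h1 := hw0 i j
    rcases eq_or_ne (μ.real (P i)) 0 with h0 | h0
    · rw [h0]; simp; positivity
    · rw [mul_comm (μ.real (P i)), ← div_div, div_mul_cancel₀ _ h0]
  have hcμν : ∀ i j, c i j * (μ (P i) * ν (P j)) = ENNReal.ofReal (w i j) := by
    intro i j
    rw [hμr, hνr, ← ENNReal.ofReal_mul measureReal_nonneg,
      ← ENNReal.ofReal_mul (by have := hw0 i j; positivity)]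
    congr 1
    rcases eq_or_ne (μ.real (P i) * ν.real (P j)) 0 with h0 | h0
    · rw [h0, mul_zero]
      refine le_antisymm (hw0 i j) ?_
      rcases mul_eq_zero.1 h0 with h0 | h0
      · exact h0 ▸ hwi i j
      · exact h0 ▸ hwj i j
    · rw [div_mul_cancel₀ _ h0]
  let β : Measure (Z × Z) := ∑ i, ∑ j, c i j • ((μ.restrict (P i)).prod (ν.restrict (P j)))
  have hle : ∀ (ρ : Measure Z), ∑ i, ρ.restrict (P i) ≤ ρ := by
    intro ρ
    rw [Measure.le_iff]
    intro s hs
    rw [Measure.finsetSum_apply]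
    simp only [Measure.restrict_apply hs]
    rw [← measure_biUnion_finset (fun i _ j _ hij => (hPd hij).mono Set.inter_subset_right
      Set.inter_subset_right) (fun i _ => hs.inter (hPm i))]
    exact measure_mono (by simp)
  refine ⟨β, ?_, ?_, ?_, ?_⟩
  · refine le_trans ?_ (hle μ)
    rw [Measure.le_iff]
    intro s hs
    rw [Measure.map_apply measurable_fst hs]
    simp only [β, Measure.finsetSum_apply, Measure.smul_apply, smul_eq_mul]
    refine Finset.sum_le_sum fun i _ => ?_
    have : ∀ j, c i j * ((μ.restrict (P i)).prod (ν.restrict (P j))) (Prod.fst ⁻¹' s)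
        = (c i j * ν (P j)) * μ.restrict (P i) s := by
      intro j
      rw [← Set.prod_univ, Measure.prod_prod, Measure.restrict_apply_univ]
      ring
    simp only [this]
    rw [← Finset.sum_mul]
    refine mul_le_of_le_one_left zero_le ?_
    refine (Finset.sum_le_sum fun j _ => hcν i j).trans ?_
    rw [← ENNReal.ofReal_sum_of_nonneg (fun j _ => div_nonneg (hw0 i j) measureReal_nonneg),
      ← Finset.sum_div]
    rw [ENNReal.ofReal_le_one]
    exact div_le_one_of_le₀ (hwa i) measureReal_nonneg
  · refine le_trans ?_ (hle ν)
    rw [Measure.le_iff]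
    intro s hs
    rw [Measure.map_apply measurable_snd hs]
    simp only [β, Measure.finsetSum_apply, Measure.smul_apply, smul_eq_mul]
    rw [Finset.sum_comm]
    refine Finset.sum_le_sum fun j _ => ?_
    have : ∀ i, c i j * ((μ.restrict (P i)).prod (ν.restrict (P j))) (Prod.snd ⁻¹' s)
        = (c i j * μ (P i)) * ν.restrict (P j) s := by
      intro i
      rw [← Set.univ_prod, Measure.prod_prod, Measure.restrict_apply_univ]
      ring
    simp only [this]
    rw [← Finset.sum_mul]
    refine mul_le_of_le_one_left zero_le ?_
    refine (Finset.sum_le_sum fun i _ => hcμ i j).trans ?_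
    rw [← ENNReal.ofReal_sum_of_nonneg (fun i _ => div_nonneg (hw0 i j) measureReal_nonneg),
      ← Finset.sum_div]
    rw [ENNReal.ofReal_le_one]
    exact div_le_one_of_le₀ (hwb j) measureReal_nonneg
  · simp only [β, Measure.finsetSum_apply, Measure.smul_apply, smul_eq_mul]
    refine Finset.sum_eq_zero fun i _ => Finset.sum_eq_zero fun j _ => ?_
    by_cases hr : r i j
    · obtain ⟨x, hx, y, hy, hxy⟩ := hr
      rw [Measure.prod_restrict]
      have hmeas : MeasurableSet {p : Z × Z | ε + 4 * t < dist p.1 p.2} :=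
        (isOpen_lt continuous_const (continuous_fst.dist continuous_snd)).measurableSet
      rw [Measure.restrict_apply hmeas]
      have : {p : Z × Z | ε + 4 * t < dist p.1 p.2} ∩ P i ×ˢ P j = ∅ := by
        rw [Set.eq_empty_iff_forall_notMem]
        rintro ⟨p, q⟩ ⟨hpq, hp, hq⟩
        simp only [Set.mem_ofPred_eq] at hpq hp hq
        have h1 := hPdiam i p hp x hx
        have h2 := hPdiam j y hy q hq
        have := dist_triangle4 p x y q
        linarith
      rw [this]; simp
    · simp [c, hwr i j hr]
  · have hβu : β Set.univ = ENNReal.ofReal (∑ i, ∑ j, w i j) := by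
      simp only [β, Measure.finsetSum_apply, Measure.smul_apply, smul_eq_mul]
      rw [ENNReal.ofReal_sum_of_nonneg (fun i _ => Finset.sum_nonneg fun j _ => hw0 i j)]
      refine Finset.sum_congr rfl fun i _ => ?_
      rw [ENNReal.ofReal_sum_of_nonneg (fun j _ => hw0 i j)]
      refine Finset.sum_congr rfl fun j _ => ?_
      rw [← Set.univ_prod_univ, Measure.prod_prod, Measure.restrict_apply_univ,
        Measure.restrict_apply_univ, hcμν]
    have hwn : 0 ≤ ∑ i, ∑ j, w i j := Finset.sum_nonneg fun i _ => Finset.sum_nonneg fun j _ => hw0 i j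
    rw [tsub_le_iff_right, hβu, ← ENNReal.ofReal_add hwn (by positivity),
      ← ENNReal.ofReal_add (by positivity) hδ, ← ofReal_measureReal (μ := μ)]
    apply ENNReal.ofReal_le_ofReal
    have hmU : MeasurableSet U := MeasurableSet.iUnion hPm
    have e1 : μ.real U = ∑ i, μ.real (P i) := by
      have := measureReal_biUnion_finset (μ := μ) (s := Finset.univ) (f := P)
        (fun i _ j _ hij => hPd hij) (fun i _ => hPm i)
      rw [← this]; simp [U]
    have e2 := measureReal_add_measureReal_compl (μ := μ) hmU
    have e3 : μ.real Uᶜ ≤ t := hμP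
    linarith

/-- Extending a sub-coupling to one with first marginal `μ`. -/
lemma extend_coupling {Z : Type*} [MeasurableSpace Z]
    (μ ν : Measure Z) [IsFiniteMeasure μ] [IsFiniteMeasure ν]
    (hle : μ Set.univ ≤ ν Set.univ) (β : Measure (Z × Z)) (h1 : β.map Prod.fst ≤ μ)
    (h2 : β.map Prod.snd ≤ ν) (δ : ENNReal) (hδ : μ Set.univ ≤ β Set.univ + δ) :
    ∃ α : Measure (Z × Z), α.map Prod.fst = μ ∧ α.map Prod.snd ≤ ν ∧
      ∀ s, α s ≤ β s + δ := by
  have hβ1 : β.map Prod.fst Set.univ = β Set.univ := by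
    rw [Measure.map_apply measurable_fst MeasurableSet.univ]; simp
  have hβ2 : β.map Prod.snd Set.univ = β Set.univ := by
    rw [Measure.map_apply measurable_snd MeasurableSet.univ]; simp
  have hfin : IsFiniteMeasure β := ⟨by
    rw [← hβ1]; exact (h1 _).trans_lt (measure_lt_top _ _)⟩
  let μ' := μ - β.map Prod.fst
  let ν' := ν - β.map Prod.snd
  have hμ' : μ' + β.map Prod.fst = μ := Measure.sub_add_cancel_of_le h1
  have hν' : ν' + β.map Prod.snd = ν := Measure.sub_add_cancel_of_le h2
  have hμu : μ' Set.univ + β Set.univ = μ Set.univ := by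
    conv_rhs => rw [← hμ', Measure.add_apply, hβ1]
  have hνu : ν' Set.univ + β Set.univ = ν Set.univ := by
    conv_rhs => rw [← hν', Measure.add_apply, hβ2]
  have hμν : μ' Set.univ ≤ ν' Set.univ := by
    rw [← hμu, ← hνu] at hle
    exact (ENNReal.add_le_add_iff_right (measure_ne_top _ _)).1 hle
  have hμδ : μ' Set.univ ≤ δ := by
    rw [← hμu, add_comm] at hδ
    exact (ENNReal.add_le_add_iff_left (measure_ne_top _ _)).1 hδ
  have hν'fin : IsFiniteMeasure ν' := inferInstance
  have hμ'fin : IsFiniteMeasure μ' := inferInstance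
  rcases eq_or_ne (ν' Set.univ) 0 with h0 | h0
  · have hz : μ' = 0 := by
      rw [← Measure.measure_univ_eq_zero]
      exact le_antisymm (h0 ▸ hμν) zero_le
    refine ⟨β, ?_, h2, fun s => le_self_add⟩
    rw [hz, zero_add] at hμ'
    exact hμ'
  have hcancel : (ν' Set.univ)⁻¹ * ν' Set.univ = 1 :=
    ENNReal.inv_mul_cancel h0 (measure_ne_top _ _)
  refine ⟨β + (ν' Set.univ)⁻¹ • μ'.prod ν', ?_, ?_, ?_⟩
  · rw [Measure.map_add _ _ measurable_fst, Measure.map_smul, Measure.map_fst_prod, smul_smul,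
      hcancel, one_smul, add_comm, hμ']
  · rw [Measure.map_add _ _ measurable_snd, Measure.map_smul, Measure.map_snd_prod, smul_smul]
    conv_rhs => rw [← hν', add_comm]
    gcongr
    rw [Measure.le_iff]
    intro s _
    rw [Measure.smul_apply, smul_eq_mul]
    refine mul_le_of_le_one_left zero_le ?_
    rw [← hcancel]
    gcongr
  · intro s
    rw [Measure.add_apply]
    gcongr
    refine (measure_mono (Set.subset_univ s)).trans ?_
    rw [Measure.smul_apply, ← Set.univ_prod_univ, Measure.prod_prod, smul_eq_mul,
      mul_left_comm, hcancel, mul_one]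
    exact hμδ

lemma measure_compl_measSupport {Z : Type*} [MetricSpace Z]
    [TopologicalSpace.SeparableSpace Z] [MeasurableSpace Z] [BorelSpace Z]
    (μ : Measure Z) : μ (measSupport μ)ᶜ = 0 := by
  haveI := UniformSpace.secondCountable_of_separable Z
  have : measSupport μ = μ.support := by
    ext x
    rw [Measure.mem_support_iff_forall]
    constructor
    · intro hx U hU
      obtain ⟨V, hVU, hV, hxV⟩ := mem_nhds_iff.1 hU
      exact (hx V hV hxV).trans_le (measure_mono hVU)
    · intro hx U hU hxU
      exact hx U (hU.mem_nhds hxU)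
  rw [this]
  exact Measure.measure_compl_support

/-- If `μ(Z) ≤ ν(Z)` and `ε := dP(μ,ν)`, there is a finite Borel measure `α` on `Z × Z` with
first marginal `μ`, second marginal `≤ ν`, supported on `supp μ × supp ν`, and with
`D(α; μ, ν) + α {(x,y) | d(x,y) > ε} ≤ ε`. -/
theorem generalized_strassen_attained {Z : Type*} [MetricSpace Z] [CompleteSpace Z]
    [TopologicalSpace.SeparableSpace Z] [MeasurableSpace Z] [BorelSpace Z]
    (μ ν : Measure Z) [IsFiniteMeasure μ] [IsFiniteMeasure ν]
    (hle : μ Set.univ ≤ ν Set.univ) :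
    ∃ α : Measure (Z × Z), IsFiniteMeasure α ∧
      α.map Prod.fst = μ ∧ α.map Prod.snd ≤ ν ∧
      α ((measSupport μ ×ˢ measSupport ν)ᶜ) = 0 ∧
      discrepancy α μ ν +
        (α {p : Z × Z | prokhorovDist μ ν < dist p.1 p.2}).toReal ≤ prokhorovDist μ ν := by
  set ε := prokhorovDist μ ν with hεdef
  let T : Set ℝ := {ε : ℝ | 0 < ε ∧ ∀ A : Set Z, IsClosed A →
    μ A ≤ ν (Metric.cthickening ε A) + ENNReal.ofReal ε ∧
    ν A ≤ μ (Metric.cthickening ε A) + ENNReal.ofReal ε}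
  have hεT : ε = sInf T := rfl
  have hT0 : ∀ e ∈ T, 0 ≤ e := fun e he => he.1.le
  have hε0 : 0 ≤ ε := Real.sInf_nonneg hT0
  have hTne : T.Nonempty := by
    refine ⟨μ.real Set.univ + ν.real Set.univ + 1, by positivity, fun A _ => ⟨?_, ?_⟩⟩
    · refine le_add_left ?_
      refine (measure_mono (Set.subset_univ A)).trans ?_
      rw [← ofReal_measureReal (μ := μ)]
      exact ENNReal.ofReal_le_ofReal (by linarith [measureReal_nonneg (μ := ν) (s := Set.univ)])
    · refine le_add_left ?_
      refine (measure_mono (Set.subset_univ A)).trans ?_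
      rw [← ofReal_measureReal (μ := ν)]
      exact ENNReal.ofReal_le_ofReal (by linarith [measureReal_nonneg (μ := μ) (s := Set.univ)])
  have hTr : ∀ e ∈ T, ∀ A : Set Z, IsClosed A →
      ν.real A ≤ μ.real (Metric.cthickening e A) + e := by
    intro e he A hA
    have h1 := (he.2 A hA).2
    rw [← ofReal_measureReal (μ := μ), ← ENNReal.ofReal_add measureReal_nonneg he.1.le] at h1
    exact ENNReal.toReal_le_of_le_ofReal (add_nonneg measureReal_nonneg he.1.le) h1
  let m : ℝ := ν.real Set.univ - μ.real Set.univ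
  have hmε : m ≤ ε := by
    refine le_csInf hTne fun e he => ?_
    have h1 := hTr e he Set.univ isClosed_univ
    have h2 : μ.real (Metric.cthickening e Set.univ) ≤ μ.real Set.univ :=
      measureReal_mono (Set.subset_univ _)
    simp only [m]; linarith
  have hkey : ∀ e, ε < e → ∀ B : Set Z, IsClosed B →
      μ.real B ≤ ν.real (Metric.cthickening e B) + (ε - m) + (e - ε) := by
    intro e he B hB
    obtain ⟨e', he'T, he'⟩ := (csInf_lt_iff ⟨0, hT0⟩ hTne).1 (hεT ▸ he)
    let A := (Metric.thickening e B)ᶜ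
    have hA : IsClosed A := Metric.isOpen_thickening.isClosed_compl
    have h1 := hTr e' he'T A hA
    have hdis : Metric.cthickening e' A ⊆ Bᶜ := by
      intro x hx hxB
      have hx' := Metric.cthickening_subset_thickening' (he'T.1.trans he') he' A hx
      obtain ⟨y, hy, hxy⟩ := Metric.mem_thickening_iff.1 hx'
      exact hy (Metric.mem_thickening_iff.2 ⟨x, hxB, by rwa [dist_comm]⟩)
    have h2 : μ.real (Metric.cthickening e' A) ≤ μ.real Bᶜ := measureReal_mono hdis
    have h3 := measureReal_add_measureReal_compl (μ := μ) hB.measurableSet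
    have h4 := measureReal_add_measureReal_compl (μ := ν)
      (Metric.isOpen_thickening (δ := e) (E := B)).measurableSet
    have h5 : ν.real (Metric.thickening e B) ≤ ν.real (Metric.cthickening e B) :=
      measureReal_mono (Metric.thickening_subset_cthickening e B)
    have h6 : ν.real A = ν.real (Metric.thickening e B)ᶜ := rfl
    simp only [m]
    linarith
  obtain ⟨β, hβ1, hβ2, hβd, hβM⟩ := exists_limit μ ν ε (μ Set.univ - ENNReal.ofReal (ε - m))
    (approx_coupling μ ν ε (ε - m) (sub_nonneg.2 hmε) hkey hε0)
  obtain ⟨α, hα1, hα2, hαs⟩ := extend_coupling μ ν hle β hβ1 hβ2 (ENNReal.ofReal (ε - m))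
    (tsub_le_iff_right.1 hβM)
  have hαu : α Set.univ = μ Set.univ := by
    conv_rhs => rw [← hα1, Measure.map_apply measurable_fst MeasurableSet.univ]
    simp
  have hαfin : IsFiniteMeasure α := ⟨by rw [hαu]; exact measure_lt_top _ _⟩
  refine ⟨α, hαfin, hα1, hα2, ?_, ?_⟩
  · rw [Set.compl_prod_eq_union]
    refine measure_mono_null (t := Prod.fst ⁻¹' (measSupport μ)ᶜ ∪ Prod.snd ⁻¹' (measSupport ν)ᶜ) ?_ ?_
    · rintro p (hp | hp)
      · exact Or.inl hp.1
      · exact Or.inr hp.2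
    · refine measure_union_null ?_ ?_
      · have h := measure_compl_measSupport μ
        refine le_antisymm ((Measure.le_map_apply measurable_fst.aemeasurable _).trans ?_) zero_le
        rw [hα1, h]
      · have h := measure_compl_measSupport ν
        refine le_antisymm ((Measure.le_map_apply measurable_snd.aemeasurable _).trans ?_) zero_le
        exact (hα2 _).trans h.le
  · have hd : (α {p : Z × Z | ε < dist p.1 p.2}).toReal ≤ ε - m := by
      refine ENNReal.toReal_le_of_le_ofReal (sub_nonneg.2 hmε) ?_
      have := hαs {p : Z × Z | ε < dist p.1 p.2}
      rwa [hβd, zero_add] at this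
    have ht1 : tvDist (α.map Prod.fst) μ ≤ 0 := by
      refine csSup_le ⟨_, ∅, MeasurableSet.empty, rfl⟩ ?_
      rintro x ⟨A, -, rfl⟩
      rw [hα1]; simp
    have ht2 : tvDist (α.map Prod.snd) ν ≤ m := by
      refine csSup_le ⟨_, ∅, MeasurableSet.empty, rfl⟩ ?_
      rintro x ⟨A, hA, rfl⟩
      have hu : (α.map Prod.snd).real Set.univ = μ.real Set.univ := by
        simp only [Measure.real]
        rw [Measure.map_apply measurable_snd MeasurableSet.univ, Set.preimage_univ, hαu]
      have hr : ∀ s, (α.map Prod.snd).real s ≤ ν.real s := fun s =>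
        ENNReal.toReal_mono (measure_ne_top _ _) (hα2 s)
      have e1 := measureReal_add_measureReal_compl (μ := α.map Prod.snd) hA
      have e2 := measureReal_add_measureReal_compl (μ := ν) hA
      change |(α.map Prod.snd).real A - ν.real A| ≤ m
      rw [abs_sub_comm, abs_of_nonneg (sub_nonneg.2 (hr A))]
      have := hr Aᶜ
      simp only [m]
      linarith
    simp only [discrepancy]
    linarith

end
end

section
/- (Strassen-type theorem for the compact Gromov-Hausdorff-Prokhorov distance.) Let 𝒳 = (X, o_X, μ_X) and 𝒴 = (Y, o_Y, μ_Y) be compact pmm spaces and ε ≥ 0. Then dc(𝒳,𝒴) ≤ ε if and only if there exist a correspondence R between X and Y and a Borel measure α on X × Y such that (o_X, o_Y) ∈ R, dis(R) ≤ 2ε, and D(α;μ_X,μ_Y) + α(Rᶜ) ≤ ε. Consequently dc(𝒳,𝒴) = inf over all such pairs (R, α) of max(dis(R)/2, D(α;μ_X,μ_Y) + α(Rᶜ)), and this infimum is attained. -/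
open MeasureTheory Topology Filter

noncomputable section

/-- A pointed measured metric space: a metric space with a distinguished point and a Borel
measure. -/
structure PMM : Type 1 where
  carrier : Type
  metric : MetricSpace carrier
  basepoint : carrier
  meas : @Measure carrier
    (@borel carrier metric.toPseudoMetricSpace.toUniformSpace.toTopologicalSpace)

attribute [instance] PMM.metric

instance PMM.instMeasurableSpace (𝒳 : PMM) : MeasurableSpace 𝒳.carrier := borel 𝒳.carrier

instance PMM.instBorelSpace (𝒳 : PMM) : BorelSpace 𝒳.carrier := ⟨rfl⟩

/-- A pmm space is boundedly compact if every closed ball is compact and has finite measure. -/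
def PMM.BoundedlyCompact (𝒳 : PMM) : Prop :=
  (∀ (x : 𝒳.carrier) (r : ℝ), IsCompact (Metric.closedBall x r)) ∧
  (∀ (x : 𝒳.carrier) (r : ℝ), 𝒳.meas (Metric.closedBall x r) ≠ ⊤)

/-- A pmm space is compact if its carrier is compact and its measure is finite. -/
def PMM.IsCompactPMM (𝒳 : PMM) : Prop :=
  CompactSpace 𝒳.carrier ∧ 𝒳.meas Set.univ ≠ ⊤

/-- A pair of maps of two pmm spaces into a common metric space. -/
structure GHPEmbedding (𝒳 𝒴 : PMM) : Type 1 where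
  Z : Type
  mZ : MetricSpace Z
  f : 𝒳.carrier → Z
  g : 𝒴.carrier → Z

attribute [instance] GHPEmbedding.mZ

/-- Both maps of a `GHPEmbedding` are isometric embeddings. -/
def GHPEmbedding.IsIsometric {𝒳 𝒴 : PMM} (e : GHPEmbedding 𝒳 𝒴) : Prop :=
  Isometry e.f ∧ Isometry e.g

/-- The quantity `max(d(f o_X, g o_Y), dH(f(X), g(Y)), dP(f_*μ_X, g_*μ_Y))` associated to a
pair of embeddings into a common space. -/
def GHPEmbedding.value {𝒳 𝒴 : PMM} (e : GHPEmbedding 𝒳 𝒴) : ℝ :=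
  letI : MeasurableSpace e.Z := borel e.Z
  max (dist (e.f 𝒳.basepoint) (e.g 𝒴.basepoint))
    (max (Metric.hausdorffDist (Set.range e.f) (Set.range e.g))
      (prokhorovDist (𝒳.meas.map e.f) (𝒴.meas.map e.g)))

/-- The Gromov-Hausdorff-Prokhorov distance of compact pmm spaces. -/
def cGHP (𝒳 𝒴 : PMM) : ℝ :=
  sInf {x : ℝ | ∃ e : GHPEmbedding 𝒳 𝒴, e.IsIsometric ∧ x = e.value}

/-- A pmm-subspace of a pmm space `𝒳`: a subset containing the basepoint together with a
measure `≤ 𝒳.meas` supported on the subset. -/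
structure SubPMM (𝒳 : PMM) where
  set : Set 𝒳.carrier
  root_mem : 𝒳.basepoint ∈ set
  meas : Measure 𝒳.carrier
  meas_le : meas ≤ 𝒳.meas
  supported : meas setᶜ = 0

/-- The pmm space associated to a pmm-subspace. -/
def SubPMM.toPMM {𝒳 : PMM} (S : SubPMM 𝒳) : PMM where
  carrier := ↥S.set
  metric := inferInstance
  basepoint := ⟨𝒳.basepoint, S.root_mem⟩
  meas := @Measure.comap ↥S.set 𝒳.carrier (borel ↥S.set) inferInstance Subtype.val S.meas

/-- The pmm-subspace ordering: inclusion of sets and inequality of measures. -/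
instance {𝒳 : PMM} : LE (SubPMM 𝒳) :=
  ⟨fun S T => S.set ⊆ T.set ∧ S.meas ≤ T.meas⟩

/-- Compactness of a pmm-subspace. -/
def SubPMM.IsCompactSub {𝒳 : PMM} (S : SubPMM 𝒳) : Prop :=
  IsCompact S.set ∧ S.meas Set.univ ≠ ⊤

/-- The closed ball of radius `r` around the basepoint, as a pmm-subspace (for `r ≥ 0` the
underlying set is exactly the closed ball; the basepoint is inserted so that the definition
makes sense for all `r`). -/
def PMM.ballSub (𝒳 : PMM) (r : ℝ) : SubPMM 𝒳 where
  set := insert 𝒳.basepoint (Metric.closedBall 𝒳.basepoint r)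
  root_mem := Set.mem_insert _ _
  meas := 𝒳.meas.restrict (insert 𝒳.basepoint (Metric.closedBall 𝒳.basepoint r))
  meas_le := Measure.restrict_le_self
  supported := by
    rw [Measure.restrict_apply ((measurableSet_closedBall.insert 𝒳.basepoint).compl),
      Set.compl_inter_self]
    simp

/-- The quantity `a(ε, r; 𝒳, 𝒴)`. -/
def aFun (ε r : ℝ) (𝒳 𝒴 : PMM) : ℝ :=
  sInf {x : ℝ | ∃ Y' : SubPMM 𝒴, Y'.IsCompactSub ∧ 𝒴.ballSub (r - ε) ≤ Y' ∧
    x = cGHP ((𝒳.ballSub r).toPMM) Y'.toPMM}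

/-- The quantity `a_ε(𝒳, 𝒴) = a(ε, 1/ε; 𝒳, 𝒴)`. -/
def aEps (ε : ℝ) (𝒳 𝒴 : PMM) : ℝ := aFun ε (1 / ε) 𝒳 𝒴

/-- The Gromov-Hausdorff-Prokhorov distance of boundedly compact pmm spaces
(with `inf ∅ = 1`). -/
def GHP (𝒳 𝒴 : PMM) : ℝ :=
  sInf (insert 1 {ε : ℝ | ε ∈ Set.Ioc (0 : ℝ) 1 ∧ max (aEps ε 𝒳 𝒴) (aEps ε 𝒴 𝒳) < ε / 2})

/-- Two pmm spaces are GHP-isometric if there is a root-preserving measure-preserving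
surjective isometry between them. -/
def GHPIsometric (𝒳 𝒴 : PMM) : Prop :=
  ∃ ρ : 𝒳.carrier → 𝒴.carrier, Isometry ρ ∧ Function.Surjective ρ ∧
    ρ 𝒳.basepoint = 𝒴.basepoint ∧ 𝒳.meas.map ρ = 𝒴.meas

/-- `r` is a continuity radius of a pmm space. -/
def PMM.ContinuityRadius (𝒳 : PMM) (r : ℝ) : Prop :=
  0 < r ∧ Metric.closedBall 𝒳.basepoint r = closure (Metric.ball 𝒳.basepoint r) ∧
    𝒳.meas (Metric.closedBall 𝒳.basepoint r \ Metric.ball 𝒳.basepoint r) = 0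

/-- A correspondence between `X` and `Y`: a Borel subset of `X × Y` whose two projections
are onto. -/
def IsCorrespondence {X Y : Type*} [MeasurableSpace X] [MeasurableSpace Y]
    (R : Set (X × Y)) : Prop :=
  MeasurableSet R ∧ (∀ x : X, ∃ y : Y, (x, y) ∈ R) ∧ (∀ y : Y, ∃ x : X, (x, y) ∈ R)

/-- The distortion of a relation `R ⊆ X × Y`. -/
def distortion {X Y : Type*} [MetricSpace X] [MetricSpace Y] (R : Set (X × Y)) : ℝ :=
  sSup {t : ℝ | ∃ p ∈ R, ∃ q ∈ R, t = |dist p.1 q.1 - dist p.2 q.2|}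

lemma aux_integrable {K : Type*} [TopologicalSpace K] [CompactSpace K] [MeasurableSpace K]
    [BorelSpace K] (μ : Measure K) [IsFiniteMeasure μ] (f : C(K, ℝ)) :
    Integrable (fun x => f x) μ :=
  f.continuous.integrable_of_hasCompactSupport (HasCompactSupport.of_compactSpace f)

lemma aux_rmk {K : Type*} [TopologicalSpace K] [T2Space K] [CompactSpace K] [MeasurableSpace K]
    [BorelSpace K] (L : C(K, ℝ) →ₗ[ℝ] ℝ) (hL : ∀ f : C(K, ℝ), (∀ x, 0 ≤ f x) → 0 ≤ L f) :
    ∃ α : Measure K, IsFiniteMeasure α ∧ ∀ f : C(K, ℝ), ∫ x, f x ∂α = L f := by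
  let Λ₀ : CompactlySupportedContinuousMap K ℝ →ₗ[ℝ] ℝ :=
    { toFun := fun f => L f.toContinuousMap
      map_add' := fun f g => by rw [← map_add]; rfl
      map_smul' := fun c f => by rw [← map_smul]; rfl }
  let Λ := PositiveLinearMap.mk₀ Λ₀ (fun f hf => hL _ (fun x => CompactlySupportedContinuousMap.le_def.1 hf x))
  refine ⟨RealRMK.rieszMeasure Λ, inferInstance, fun f => ?_⟩
  exact RealRMK.integral_rieszMeasure Λ
    (CompactlySupportedContinuousMap.continuousMapEquiv f)

/-- Integration as a linear functional. -/
def auxInt {K : Type*} [TopologicalSpace K] [CompactSpace K] [MeasurableSpace K]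
    [BorelSpace K] (μ : Measure K) [IsFiniteMeasure μ] : C(K, ℝ) →ₗ[ℝ] ℝ where
  toFun f := ∫ x, f x ∂μ
  map_add' f g := by
    simpa using integral_add (aux_integrable μ f) (aux_integrable μ g)
  map_smul' c f := by
    simpa using integral_const_mul c (fun x => f x)

lemma aux_ext {K : Type*} [MetricSpace K] [CompactSpace K] [MeasurableSpace K]
    [BorelSpace K] (μ ν : Measure K) [IsFiniteMeasure μ] [IsFiniteMeasure ν]
    (h : ∀ f : C(K, ℝ), ∫ x, f x ∂μ = ∫ x, f x ∂ν) : μ = ν :=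
  ext_of_forall_integral_eq_of_IsFiniteMeasure (fun f => h f.toContinuousMap)

section
variable {X Y : Type*} [MetricSpace X] [CompactSpace X] [MeasurableSpace X] [BorelSpace X]
  [MetricSpace Y] [CompactSpace Y] [MeasurableSpace Y] [BorelSpace Y]

lemma aux_layer (μ : Measure X) (ν : Measure Y) [IsFiniteMeasure μ] [IsFiniteMeasure ν]
    (R : Set (X × Y)) (ε : ℝ) (hε : 0 ≤ ε)
    (h : ∀ B : Set Y, IsClosed B → ν B ≤ μ {x | ∃ y ∈ B, (x, y) ∈ R} + ENNReal.ofReal ε)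
    (u : C(Y, ℝ)) (v : C(X, ℝ)) (T : ℝ) (hT : 0 ≤ T) (hu : ∀ y, 0 ≤ u y) (huT : ∀ y, u y ≤ T)
    (hv : ∀ x, 0 ≤ v x) (huv : ∀ x y, (x, y) ∈ R → u y ≤ v x) :
    ∫ y, u y ∂ν ≤ ∫ x, v x ∂μ + T * ε := by
  have key : ∫⁻ y, ENNReal.ofReal (u y) ∂ν ≤
      ∫⁻ x, ENNReal.ofReal (v x) ∂μ + ENNReal.ofReal T * ENNReal.ofReal ε := by
    rw [lintegral_eq_lintegral_meas_le ν (Eventually.of_forall hu) u.continuous.aemeasurable,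
      lintegral_eq_lintegral_meas_le μ (Eventually.of_forall hv) v.continuous.aemeasurable]
    calc ∫⁻ t in Set.Ioi 0, ν {a | t ≤ u a}
        ≤ ∫⁻ t in Set.Ioi 0, (μ {a | t ≤ v a} +
            (Set.Iic T).indicator (fun _ => ENNReal.ofReal ε) t) := by
          refine lintegral_mono (fun t => ?_)
          by_cases ht : t ≤ T
          · have : t ∈ Set.Iic T := ht
            simp only [Set.indicator_of_mem this]
            refine (h _ (isClosed_le continuous_const u.continuous)).trans ?_
            gcongr
            rintro ⟨y, hy, hxy⟩
            exact le_trans hy (huv _ y hxy)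
          · have : {a | t ≤ u a} = ∅ := by
              ext y
              simp only [Set.mem_ofPred_eq, Set.mem_empty_iff_false, iff_false]
              intro hy
              exact ht (hy.trans (huT y))
            simp [this]
      _ = (∫⁻ t in Set.Ioi 0, μ {a | t ≤ v a}) + ENNReal.ofReal T * ENNReal.ofReal ε := by
          rw [lintegral_add_right _ (measurable_const.indicator measurableSet_Iic)]
          congr 1
          rw [lintegral_indicator measurableSet_Iic, Measure.restrict_restrict measurableSet_Iic,
            Set.inter_comm, Set.Ioi_inter_Iic]
          simp [mul_comm]
  rw [integral_eq_lintegral_of_nonneg_ae (Eventually.of_forall hu)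
    u.continuous.aestronglyMeasurable, integral_eq_lintegral_of_nonneg_ae
    (Eventually.of_forall hv) v.continuous.aestronglyMeasurable]
  have hfin : ∫⁻ x, ENNReal.ofReal (v x) ∂μ ≠ ⊤ :=
    (aux_integrable μ v).lintegral_lt_top.ne
  have := ENNReal.toReal_mono (by finiteness) key
  rwa [ENNReal.toReal_add hfin (by finiteness), ENNReal.toReal_mul, ENNReal.toReal_ofReal hT,
    ENNReal.toReal_ofReal hε] at this

lemma aux_dual [Nonempty X] (μ : Measure X) (ν : Measure Y) [IsFiniteMeasure μ]
    [IsFiniteMeasure ν]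
    (R : Set (X × Y)) (ε : ℝ) (hε : 0 ≤ ε) (hMN : μ.real Set.univ ≤ ν.real Set.univ)
    (h : ∀ B : Set Y, IsClosed B → ν B ≤ μ {x | ∃ y ∈ B, (x, y) ∈ R} + ENNReal.ofReal ε)
    (f : C(X, ℝ)) (g : C(Y, ℝ)) (t : ℝ) (ht : 0 ≤ t) (hg : ∀ y, 0 ≤ g y)
    (hR : ∀ x y, (x, y) ∈ R → 0 ≤ f x + g y) (hall : ∀ x y, 0 ≤ f x + g y + t) :
    0 ≤ ∫ x, f x ∂μ + ∫ y, g y ∂ν + t * (ε - (ν.real Set.univ - μ.real Set.univ)) := by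
  have hκ : ν.real Set.univ ≤ μ.real Set.univ + ε := by
    have h1 : ν Set.univ ≤ μ Set.univ + ENNReal.ofReal ε :=
      (h Set.univ isClosed_univ).trans (by gcongr; exact Set.subset_univ _)
    have := ENNReal.toReal_mono (by finiteness) h1
    rwa [ENNReal.toReal_add (by finiteness) (by finiteness), ENNReal.toReal_ofReal hε] at this
  have hgi : 0 ≤ ∫ y, g y ∂ν := integral_nonneg hg
  obtain ⟨x₀, -, hx₀⟩ := isCompact_univ.exists_isMinOn (Set.univ_nonempty (α := X))
    f.continuous.continuousOn
  have hx₀ : ∀ x, f x₀ ≤ f x := fun x => hx₀ (Set.mem_univ x)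
  by_cases hs : 0 ≤ f x₀
  · have : 0 ≤ ∫ x, f x ∂μ := integral_nonneg (fun x => hs.trans (hx₀ x))
    have : 0 ≤ t * (ε - (ν.real Set.univ - μ.real Set.univ)) :=
      mul_nonneg ht (by linarith)
    linarith
  · push Not at hs
    obtain ⟨s, hsdef⟩ : ∃ s, s = - f x₀ := ⟨_, rfl⟩
    have hs0 : 0 < s := by linarith
    let u : C(Y, ℝ) := ⟨fun y => max (s - g y) 0, by fun_prop⟩
    let v : C(X, ℝ) := ⟨fun x => s + f x, by fun_prop⟩
    have hm : 0 ≤ min s t := le_min hs0.le ht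
    have h1 := aux_layer μ ν R ε hε h u v (min s t) hm
      (fun y => le_max_right _ _)
      (fun y => by
        refine max_le (le_min ?_ ?_) hm
        · linarith [hg y]
        · linarith [hall x₀ y])
      (fun x => by
        change 0 ≤ s + f x
        linarith [hx₀ x])
      (fun x y hxy => by
        refine max_le ?_ ?_
        · change s - g y ≤ s + f x
          linarith [hR x y hxy]
        · change 0 ≤ s + f x
          linarith [hx₀ x])
    have h2 : ∫ x, v x ∂μ = s * μ.real Set.univ + ∫ x, f x ∂μ := by
      change ∫ x, (s + f x) ∂μ = _
      rw [integral_add (integrable_const _) (aux_integrable μ f)]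
      simp [mul_comm]
    have h3 : s * ν.real Set.univ - ∫ y, g y ∂ν ≤ ∫ y, u y ∂ν := by
      have : s * ν.real Set.univ - ∫ y, g y ∂ν = ∫ y, (s - g y) ∂ν := by
        rw [integral_sub (integrable_const _) (aux_integrable ν g)]
        simp [mul_comm]
      rw [this]
      exact integral_mono ((integrable_const _).sub (aux_integrable ν g)) (aux_integrable ν u)
        (fun y => le_max_left _ _)
    have h4 : min s t * (ν.real Set.univ - μ.real Set.univ) ≤
        s * (ν.real Set.univ - μ.real Set.univ) :=
      mul_le_mul_of_nonneg_right (min_le_left _ _) (by linarith)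
    have h5 : min s t * (ε - (ν.real Set.univ - μ.real Set.univ)) ≤
        t * (ε - (ν.real Set.univ - μ.real Set.univ)) :=
      mul_le_mul_of_nonneg_right (min_le_right _ _) (by linarith)
    nlinarith

lemma aux_functional [Nonempty X] (μ : Measure X) (ν : Measure Y) [IsFiniteMeasure μ]
    [IsFiniteMeasure ν]
    (R : Set (X × Y)) (ε : ℝ) (hε : 0 ≤ ε) (hMN : μ.real Set.univ ≤ ν.real Set.univ)
    (h : ∀ B : Set Y, IsClosed B → ν B ≤ μ {x | ∃ y ∈ B, (x, y) ∈ R} + ENNReal.ofReal ε) :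
    ∃ L : C(X × Y, ℝ) →ₗ[ℝ] ℝ, ∀ (f : C(X, ℝ)) (g : C(Y, ℝ)) (t : ℝ) (k : C(X × Y, ℝ)),
      0 ≤ t → (∀ y, 0 ≤ g y) → (∀ x y, (x, y) ∈ R → 0 ≤ f x + g y + k (x, y)) →
      (∀ x y, 0 ≤ f x + g y + t + k (x, y)) →
      0 ≤ ∫ x, f x ∂μ + ∫ y, g y ∂ν + t * (ε - (ν.real Set.univ - μ.real Set.univ)) + L k := by
  let E := (C(X, ℝ) × C(Y, ℝ)) × (ℝ × C(X × Y, ℝ))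
  let s : PointedCone ℝ E :=
    { carrier := {e | 0 ≤ e.2.1 ∧ (∀ y, 0 ≤ e.1.2 y) ∧
        (∀ x y, (x, y) ∈ R → 0 ≤ e.1.1 x + e.1.2 y + e.2.2 (x, y)) ∧
        (∀ x y, 0 ≤ e.1.1 x + e.1.2 y + e.2.1 + e.2.2 (x, y))}
      add_mem' := by
        rintro ⟨⟨f, g⟩, t, k⟩ ⟨⟨f', g'⟩, t', k'⟩ ⟨h1, h2, h3, h4⟩ ⟨h1', h2', h3', h4'⟩
        dsimp only at *
        refine ⟨add_nonneg h1 h1', fun y => add_nonneg (h2 y) (h2' y), fun x y hxy => ?_,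
          fun x y => ?_⟩
        · have a := h3 x y hxy
          have b := h3' x y hxy
          change 0 ≤ (f x + f' x) + (g y + g' y) + (k (x, y) + k' (x, y))
          linarith
        · have a := h4 x y
          have b := h4' x y
          change 0 ≤ (f x + f' x) + (g y + g' y) + (t + t') + (k (x, y) + k' (x, y))
          linarith
      zero_mem' := by simp
      smul_mem' := by
        rintro ⟨c, hc⟩ ⟨⟨f, g⟩, t, k⟩ ⟨h1, h2, h3, h4⟩
        dsimp only at *
        refine ⟨mul_nonneg hc h1, fun y => mul_nonneg hc (h2 y), fun x y hxy => ?_,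
          fun x y => ?_⟩
        · have a := mul_nonneg hc (h3 x y hxy)
          change 0 ≤ c * f x + c * g y + c * k (x, y)
          linarith
        · have a := mul_nonneg hc (h4 x y)
          change 0 ≤ c * f x + c * g y + c * t + c * k (x, y)
          linarith }
  let φ : E →ₗ[ℝ] ℝ :=
    (auxInt μ).comp (LinearMap.fst ℝ _ _ ∘ₗ LinearMap.fst ℝ _ _) +
    (auxInt ν).comp (LinearMap.snd ℝ _ _ ∘ₗ LinearMap.fst ℝ _ _) +
    (ε - (ν.real Set.univ - μ.real Set.univ)) •
      (LinearMap.fst ℝ _ _ ∘ₗ LinearMap.snd ℝ _ _)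
  have hφ : ∀ f g t k, φ ((f, g), (t, k)) = ∫ x, f x ∂μ + ∫ y, g y ∂ν +
      t * (ε - (ν.real Set.univ - μ.real Set.univ)) := by
    intro f g t k
    change ∫ x, f x ∂μ + ∫ y, g y ∂ν + (ε - (ν.real Set.univ - μ.real Set.univ)) * t = _
    rw [mul_comm t]
  let D : Submodule ℝ E := LinearMap.ker (LinearMap.snd ℝ ℝ (C(X × Y, ℝ)) ∘ₗ
    LinearMap.snd ℝ (C(X, ℝ) × C(Y, ℝ)) (ℝ × C(X × Y, ℝ)))
  have hD : ∀ f g t k, (((f, g), (t, k)) : E) ∈ D ↔ k = 0 := by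
    intro f g t k
    simp [D]
  let F : E →ₗ.[ℝ] ℝ := ⟨D, φ ∘ₗ D.subtype⟩
  obtain ⟨G, hG1, hG2⟩ := riesz_extension s F
    (by
      rintro ⟨⟨⟨f, g⟩, t, k⟩, hm⟩ ⟨h1, h2, h3, h4⟩
      have hk : k = 0 := (hD f g t k).1 hm
      subst hk
      change 0 ≤ φ ((f, g), (t, 0))
      rw [hφ]
      exact aux_dual μ ν R ε hε hMN h f g t h1 h2 (fun x y hxy => by simpa using h3 x y hxy)
        (fun x y => by simpa using h4 x y))
    (by
      rintro ⟨⟨f, g⟩, t, k⟩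
      refine ⟨⟨((ContinuousMap.const X (‖f‖ + ‖k‖), -g), (-t, 0)), (hD _ _ _ _).2 rfl⟩, ?_⟩
      have a : ∀ x, -‖f‖ ≤ f x := fun x => (abs_le.1 (f.norm_coe_le_norm x)).1
      have b : ∀ x, -‖k‖ ≤ k x := fun x => (abs_le.1 (k.norm_coe_le_norm x)).1
      refine ⟨?_, fun y => ?_, fun x y _ => ?_, fun x y => ?_⟩
      · change 0 ≤ -t + t
        linarith
      · change 0 ≤ -g y + g y
        linarith
      · change 0 ≤ (‖f‖ + ‖k‖ + f x) + (-g y + g y) + (0 + k (x, y))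
        linarith [a x, b (x, y)]
      · change 0 ≤ (‖f‖ + ‖k‖ + f x) + (-g y + g y) + (-t + t) + (0 + k (x, y))
        linarith [a x, b (x, y)])
  refine ⟨G ∘ₗ LinearMap.inr ℝ _ _ ∘ₗ LinearMap.inr ℝ _ _, fun f g t k ht hg h1 h2 => ?_⟩
  have h3 := hG2 ((f, g), (t, k)) ⟨ht, hg, h1, h2⟩
  have h4 := hG1 ⟨((f, g), (t, 0)), (hD _ _ _ _).2 rfl⟩
  have h5 : (((f, g), (t, k)) : E) = ((f, g), (t, 0)) + ((0, 0), (0, k)) := by simp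
  rw [h5, map_add] at h3
  change G ((f, g), (t, 0)) = φ ((f, g), (t, 0)) at h4
  rw [h4, hφ] at h3
  exact h3

lemma aux_strassen [Nonempty X] (μ : Measure X) (ν : Measure Y) [IsFiniteMeasure μ]
    [IsFiniteMeasure ν]
    (R : Set (X × Y)) (hRc : IsClosed R) (hRn : R.Nonempty)
    (ε : ℝ) (hε : 0 ≤ ε) (hMN : μ.real Set.univ ≤ ν.real Set.univ)
    (h : ∀ B : Set Y, IsClosed B → ν B ≤ μ {x | ∃ y ∈ B, (x, y) ∈ R} + ENNReal.ofReal ε) :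
    ∃ α : Measure (X × Y), IsFiniteMeasure α ∧ α.map Prod.fst = μ ∧ α.map Prod.snd ≤ ν ∧
      (α Rᶜ).toReal ≤ ε - (ν.real Set.univ - μ.real Set.univ) := by
  obtain ⟨L, hL⟩ := aux_functional μ ν R ε hε hMN h
  obtain ⟨α, hα, hαL⟩ := aux_rmk L (fun k hk => by
    simpa using hL 0 0 0 k le_rfl (by simp) (by simp [hk]) (by simp [hk]))
  refine ⟨α, hα, ?_, ?_, ?_⟩
  · apply aux_ext
    intro f
    rw [integral_map measurable_fst.aemeasurable f.continuous.aestronglyMeasurable]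
    have h0 := hαL (f.comp ContinuousMap.fst)
    have h1 := hL f 0 0 (-(f.comp ContinuousMap.fst)) le_rfl (by simp) (by simp) (by simp)
    have h2 := hL (-f) 0 0 ((f.comp ContinuousMap.fst)) le_rfl (by simp) (by simp) (by simp)
    simp [integral_neg] at h0 h1 h2
    linarith
  · let L2 : C(Y, ℝ) →ₗ[ℝ] ℝ := auxInt ν - auxInt (α.map Prod.snd)
    have hL2 : ∀ g, L2 g = ∫ y, g y ∂ν - ∫ y, g y ∂(α.map Prod.snd) := fun g => rfl
    obtain ⟨σ, hσ, hσL⟩ := aux_rmk L2 (fun g hg => by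
      rw [hL2, integral_map measurable_snd.aemeasurable g.continuous.aestronglyMeasurable]
      have h0 := hαL (g.comp ContinuousMap.snd)
      have h1 := hL 0 g 0 (-(g.comp ContinuousMap.snd)) le_rfl hg (by simp) (by simp)
      simp at h0 h1
      linarith)
    have : ν = α.map Prod.snd + σ := by
      apply aux_ext
      intro g
      rw [integral_add_measure (aux_integrable _ g) (aux_integrable _ g), hσL, hL2]
      ring
    rw [this]
    exact Measure.le_add_right le_rfl
  · let k : ℕ → C(X × Y, ℝ) := fun n => ⟨fun p => min 1 (n * Metric.infDist p R), by
      have := Metric.continuous_infDist_pt R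
      fun_prop⟩
    have hk : ∀ n, ∫ p, k n p ∂α ≤ ε - (ν.real Set.univ - μ.real Set.univ) := by
      intro n
      rw [hαL]
      have := hL 0 0 1 (-(k n)) zero_le_one (by simp)
        (fun x y hxy => by simp [k, Metric.infDist_zero_of_mem hxy])
        (fun x y => by simp [k])
      simp at this
      linarith
    have hlim : Tendsto (fun n => ∫ p, k n p ∂α) atTop
        (𝓝 (∫ p, Rᶜ.indicator (fun _ => (1 : ℝ)) p ∂α)) := by
      refine tendsto_integral_of_dominated_convergence (fun _ => 1)
        (fun n => (k n).continuous.aestronglyMeasurable) (integrable_const _) ?_ ?_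
      · intro n
        refine Eventually.of_forall (fun p => ?_)
        have : 0 ≤ (n : ℝ) * Metric.infDist p R :=
          mul_nonneg (Nat.cast_nonneg _) Metric.infDist_nonneg
        simp only [k, ContinuousMap.coe_mk, Real.norm_eq_abs]
        rw [abs_of_nonneg (le_min zero_le_one this)]
        exact min_le_left _ _
      · refine Eventually.of_forall (fun p => ?_)
        by_cases hp : p ∈ R
        · simp [k, hp, Metric.infDist_zero_of_mem hp]
        · have hpos : 0 < Metric.infDist p R := (hRc.notMem_iff_infDist_pos hRn).1 hp
          have : p ∈ Rᶜ := hp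
          rw [Set.indicator_of_mem this]
          obtain ⟨m, hm⟩ := exists_nat_ge (1 / Metric.infDist p R)
          refine tendsto_const_nhds.congr' ?_
          filter_upwards [eventually_ge_atTop m] with n hn
          have h1 : 1 / Metric.infDist p R ≤ n := hm.trans (by exact_mod_cast hn)
          rw [div_le_iff₀ hpos] at h1
          simp [k, h1]
    have := le_of_tendsto' hlim hk
    rw [integral_indicator hRc.measurableSet.compl] at this
    simpa [Measure.real] using this
end

section
variable {X Y : Type*} [MetricSpace X] [CompactSpace X] [MeasurableSpace X] [BorelSpace X]
  [MetricSpace Y] [CompactSpace Y] [MeasurableSpace Y] [BorelSpace Y]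

/-- `d` behaves like the cross-distance of two isometric embeddings with parameter `δ`. -/
structure AuxGood (oX : X) (oY : Y) (μ : Measure X) (ν : Measure Y) (δ : ℝ) (d : X → Y → ℝ) :
    Prop where
  nonneg : ∀ x y, 0 ≤ d x y
  lip : ∀ x x' y y', d x y ≤ dist x x' + d x' y' + dist y y'
  tri : ∀ x x' y y', |dist x x' - dist y y'| ≤ d x y + d x' y'
  base : d oX oY ≤ δ
  left : ∀ x, ∃ y, d x y ≤ δ
  right : ∀ y, ∃ x, d x y ≤ δ
  mX : ∀ A : Set X, IsClosed A → μ A ≤ ν {y | ∃ x ∈ A, d x y ≤ δ} + ENNReal.ofReal δ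
  mY : ∀ B : Set Y, IsClosed B → ν B ≤ μ {x | ∃ y ∈ B, d x y ≤ δ} + ENNReal.ofReal δ

lemma aux_lim_le (U : Ultrafilter ℕ) (D : ℕ → X → Y → ℝ) (d : X → Y → ℝ) (δ : ℕ → ℝ) (ε : ℝ)
    (hlip : ∀ n x x' y y', D n x y ≤ dist x x' + D n x' y' + dist y y')
    (hδ : Tendsto δ U (𝓝 ε)) (hd : ∀ x y, Tendsto (fun n => D n x y) U (𝓝 (d x y)))
    (x : X) (y : Y) (xs : ℕ → X) (ys : ℕ → Y) (hx : Tendsto xs U (𝓝 x))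
    (hy : Tendsto ys U (𝓝 y)) (h : ∀ᶠ n in U, D n (xs n) (ys n) ≤ δ n) : d x y ≤ ε := by
  have h1 : Tendsto (fun n => dist x (xs n) + δ n + dist y (ys n)) U (𝓝 (0 + ε + 0)) := by
    refine (Tendsto.add ?_ hδ).add ?_
    · simpa using (tendsto_const_nhds (x := x)).dist hx
    · simpa using (tendsto_const_nhds (x := y)).dist hy
  have := le_of_tendsto_of_tendsto (hd x y) h1 (by
    filter_upwards [h] with n hn
    linarith [hlip n x (xs n) y (ys n)])
  linarith

lemma aux_ultra {K : Type*} [TopologicalSpace K] [CompactSpace K] (U : Ultrafilter ℕ)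
    (xs : ℕ → K) : ∃ x, Tendsto xs U (𝓝 x) := by
  obtain ⟨x, -, hx⟩ := isCompact_univ.ultrafilter_le_nhds (U.map xs) (by simp)
  exact ⟨x, hx⟩

lemma aux_half (U : Ultrafilter ℕ) (D : ℕ → X → Y → ℝ) (d : X → Y → ℝ) (δ : ℕ → ℝ) (ε : ℝ)
    (hlip : ∀ n x x' y y', D n x y ≤ dist x x' + D n x' y' + dist y y')
    (hδ : Tendsto δ U (𝓝 ε)) (hd : ∀ x y, Tendsto (fun n => D n x y) U (𝓝 (d x y)))
    (μ : Measure X) (ν : Measure Y) [IsFiniteMeasure μ] [IsFiniteMeasure ν]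
    (A : Set X) (hA : IsClosed A)
    (h : ∀ n, μ A ≤ ν {y | ∃ x ∈ A, D n x y ≤ δ n} + ENNReal.ofReal (δ n)) :
    μ A ≤ ν {y | ∃ x ∈ A, d x y ≤ ε} + ENNReal.ofReal ε := by
  by_contra hcon
  push Not at hcon
  obtain ⟨V, hSV, hV, hνV⟩ := Set.exists_isOpen_lt_of_lt _ _ (lt_tsub_iff_right.2 hcon)
  have hev : ∀ᶠ n in U, {y | ∃ x ∈ A, D n x y ≤ δ n} ⊆ V := by
    by_contra hne
    rw [← Ultrafilter.eventually_not] at hne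
    have : ∀ n, ∃ p : X × Y, ¬ ({y | ∃ x ∈ A, D n x y ≤ δ n} ⊆ V) →
        (p.1 ∈ A ∧ D n p.1 p.2 ≤ δ n ∧ p.2 ∉ V) := by
      intro n
      by_cases hn : {y | ∃ x ∈ A, D n x y ≤ δ n} ⊆ V
      · obtain ⟨m, hm⟩ := hne.exists
        obtain ⟨y, ⟨x, -, -⟩, -⟩ := Set.not_subset.1 hm
        exact ⟨(x, y), fun h' => absurd hn h'⟩
      · obtain ⟨y, ⟨x, hx, hxy⟩, hy⟩ := Set.not_subset.1 hn
        exact ⟨(x, y), fun _ => ⟨hx, hxy, hy⟩⟩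
    choose p hp using this
    obtain ⟨x, hx⟩ := aux_ultra U (fun n => (p n).1)
    obtain ⟨y, hy⟩ := aux_ultra U (fun n => (p n).2)
    have h1 : d x y ≤ ε := aux_lim_le U D d δ ε hlip hδ hd x y _ _ hx hy (by
      filter_upwards [hne] with n hn using (hp n hn).2.1)
    have h2 : x ∈ A := hA.mem_of_tendsto hx (by
      filter_upwards [hne] with n hn using (hp n hn).1)
    have h3 : y ∈ Vᶜ := hV.isClosed_compl.mem_of_tendsto hy (by
      filter_upwards [hne] with n hn using (hp n hn).2.2)
    exact h3 (hSV ⟨x, h2, h1⟩)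
  have hlim : Tendsto (fun n => ν V + ENNReal.ofReal (δ n)) U (𝓝 (ν V + ENNReal.ofReal ε)) :=
    tendsto_const_nhds.add (ENNReal.tendsto_ofReal hδ)
  have hle : μ A ≤ ν V + ENNReal.ofReal ε := ge_of_tendsto hlim (by
    filter_upwards [hev] with n hn
    exact (h n).trans (by gcongr))
  exact absurd (lt_tsub_iff_right.1 hνV) (not_lt.2 hle)

lemma aux_limit (oX : X) (oY : Y) (μ : Measure X) (ν : Measure Y) [IsFiniteMeasure μ]
    [IsFiniteMeasure ν] (ε : ℝ)
    (h : ∀ n : ℕ, ∃ d, AuxGood oX oY μ ν (ε + 1 / ((n : ℝ) + 1)) d) :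
    ∃ d, AuxGood oX oY μ ν ε d := by
  choose D hD using h
  let U : Ultrafilter ℕ := hyperfilter ℕ
  have hδ : Tendsto (fun n : ℕ => ε + 1 / ((n : ℝ) + 1)) U (𝓝 ε) := by
    have := (tendsto_const_nhds (x := ε)).add (tendsto_one_div_add_atTop_nhds_zero_nat (𝕜 := ℝ))
    rw [add_zero] at this
    exact this.mono_left Nat.hyperfilter_le_atTop
  have hlim : ∀ x y, ∃ l, Tendsto (fun n => D n x y) U (𝓝 l) := by
    intro x y
    have hb : ∀ n, D n x y ∈ Set.Icc 0 (dist x oX + (ε + 1) + dist y oY) := by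
      intro n
      refine ⟨(hD n).nonneg x y, ((hD n).lip x oX y oY).trans ?_⟩
      have : 1 / ((n : ℝ) + 1) ≤ 1 := by
        rw [div_le_one (by positivity)]
        linarith [(Nat.cast_nonneg n : (0 : ℝ) ≤ n)]
      linarith [(hD n).base]
    obtain ⟨l, -, hl⟩ := isCompact_Icc.ultrafilter_le_nhds (U.map (fun n => D n x y))
      (le_principal_iff.2 (Filter.mem_map.2 (Eventually.of_forall hb)))
    exact ⟨l, hl⟩
  choose d hd using hlim
  have hlipD : ∀ n x x' y y', D n x y ≤ dist x x' + D n x' y' + dist y y' :=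
    fun n => (hD n).lip
  refine ⟨d, ?_, ?_, ?_, ?_, ?_, ?_, ?_, ?_⟩
  · exact fun x y => ge_of_tendsto' (hd x y) (fun n => (hD n).nonneg x y)
  · exact fun x x' y y' => le_of_tendsto_of_tendsto' (hd x y)
      (((hd x' y').const_add _).add_const _) (fun n => (hD n).lip x x' y y')
  · exact fun x x' y y' => ge_of_tendsto' ((hd x y).add (hd x' y'))
      (fun n => (hD n).tri x x' y y')
  · exact le_of_tendsto_of_tendsto' (hd oX oY) hδ (fun n => (hD n).base)
  · intro x
    choose ys hys using fun n => (hD n).left x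
    obtain ⟨y, hy⟩ := aux_ultra U ys
    exact ⟨y, aux_lim_le U D d _ ε hlipD hδ hd x y (fun _ => x) ys tendsto_const_nhds hy
      (Eventually.of_forall hys)⟩
  · intro y
    choose xs hxs using fun n => (hD n).right y
    obtain ⟨x, hx⟩ := aux_ultra U xs
    exact ⟨x, aux_lim_le U D d _ ε hlipD hδ hd x y xs (fun _ => y) hx tendsto_const_nhds
      (Eventually.of_forall hxs)⟩
  · exact fun A hA => aux_half U D d _ ε hlipD hδ hd μ ν A hA (fun n => (hD n).mX A hA)
  · exact fun B hB => aux_half U (fun n y x => D n x y) (fun y x => d x y) _ ε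
      (fun n y y' x x' => by linarith [hlipD n x x' y y']) hδ (fun y x => hd x y) ν μ B hB
      (fun n => (hD n).mY B hB)

lemma aux_prok_set_nonempty {Z : Type*} [MetricSpace Z] [MeasurableSpace Z]
    (μ ν : Measure Z) [IsFiniteMeasure μ] [IsFiniteMeasure ν] :
    {ε : ℝ | 0 < ε ∧ ∀ A : Set Z, IsClosed A →
      μ A ≤ ν (Metric.cthickening ε A) + ENNReal.ofReal ε ∧
      ν A ≤ μ (Metric.cthickening ε A) + ENNReal.ofReal ε}.Nonempty := by
  refine ⟨μ.real Set.univ + ν.real Set.univ + 1, by positivity, fun A _ => ⟨?_, ?_⟩⟩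
  · refine le_add_left ?_
    rw [← ofReal_measureReal]
    refine ENNReal.ofReal_le_ofReal ?_
    linarith [measureReal_mono (μ := μ) (Set.subset_univ A),
      measureReal_nonneg (μ := ν) (s := Set.univ)]
  · refine le_add_left ?_
    rw [← ofReal_measureReal]
    refine ENNReal.ofReal_le_ofReal ?_
    linarith [measureReal_mono (μ := ν) (Set.subset_univ A),
      measureReal_nonneg (μ := μ) (s := Set.univ)]

lemma aux_push {Z : Type*} [MetricSpace Z] [MeasurableSpace Z] [BorelSpace Z]
    (f : X → Z) (g : Y → Z) (hf : Isometry f) (hg : Isometry g) (μ : Measure X) (ν : Measure Y)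
    (η δ : ℝ) (hη : 0 < η) (hηδ : η ≤ δ) (A : Set X) (hA : IsClosed A)
    (h : μ.map f (f '' A) ≤ ν.map g (Metric.cthickening η (f '' A)) + ENNReal.ofReal η) :
    μ A ≤ ν {y | ∃ x ∈ A, dist (f x) (g y) ≤ δ} + ENNReal.ofReal δ := by
  have hc : IsCompact (f '' A) := hA.isCompact.image hf.continuous
  rw [Measure.map_apply hf.continuous.measurable hc.isClosed.measurableSet,
    Measure.map_apply hg.continuous.measurable Metric.isClosed_cthickening.measurableSet,
    Set.preimage_image_eq _ hf.injective] at h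
  refine h.trans (add_le_add (measure_mono ?_) (ENNReal.ofReal_le_ofReal hηδ))
  intro y hy
  rw [Set.mem_preimage, hc.cthickening_eq_biUnion_closedBall hη.le] at hy
  simp only [Set.mem_iUnion, Metric.mem_closedBall] at hy
  obtain ⟨_, ⟨x, hx, rfl⟩, hxy⟩ := hy
  exact ⟨x, hx, by rw [dist_comm]; exact hxy.trans hηδ⟩

lemma aux_good_of_embed {Z : Type*} [MetricSpace Z] [MeasurableSpace Z] [BorelSpace Z]
    (f : X → Z) (g : Y → Z) (hf : Isometry f) (hg : Isometry g) (μ : Measure X) (ν : Measure Y)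
    [IsFiniteMeasure μ] [IsFiniteMeasure ν] (oX : X) (oY : Y) (δ : ℝ)
    (h1 : dist (f oX) (g oY) < δ)
    (h2 : Metric.hausdorffDist (Set.range f) (Set.range g) < δ)
    (h3 : prokhorovDist (μ.map f) (ν.map g) < δ) :
    AuxGood oX oY μ ν δ (fun x y => dist (f x) (g y)) := by
  have hne : Metric.hausdorffEDist (Set.range f) (Set.range g) ≠ ⊤ :=
    Metric.hausdorffEDist_ne_top_of_nonempty_of_bounded ⟨f oX, oX, rfl⟩ ⟨g oY, oY, rfl⟩
      (isCompact_range hf.continuous).isBounded (isCompact_range hg.continuous).isBounded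
  obtain ⟨η, ⟨hη, hp⟩, hηδ⟩ := exists_lt_of_csInf_lt (aux_prok_set_nonempty _ _) h3
  refine ⟨fun _ _ => dist_nonneg, ?_, ?_, h1.le, ?_, ?_, ?_, ?_⟩
  · intro x x' y y'
    rw [← hf.dist_eq x x', ← hg.dist_eq y y', dist_comm (g y)]
    exact dist_triangle4 _ _ _ _
  · intro x x' y y'
    rw [← hf.dist_eq x x', ← hg.dist_eq y y', abs_le]
    have a := dist_triangle4 (g y) (f x) (f x') (g y')
    have b := dist_triangle4 (f x) (g y) (g y') (f x')
    rw [dist_comm (g y) (f x)] at a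
    rw [dist_comm (g y') (f x')] at b
    constructor <;> linarith
  · intro x
    obtain ⟨_, ⟨y, rfl⟩, hy⟩ := Metric.exists_dist_lt_of_hausdorffDist_lt (Set.mem_range_self x) h2 hne
    exact ⟨y, hy.le⟩
  · intro y
    obtain ⟨_, ⟨x, rfl⟩, hx⟩ := Metric.exists_dist_lt_of_hausdorffDist_lt' (Set.mem_range_self y) h2 hne
    exact ⟨x, hx.le⟩
  · intro A hA
    exact aux_push f g hf hg μ ν η δ hη hηδ.le A hA
      (hp _ (hA.isCompact.image hf.continuous).isClosed).1
  · intro B hB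
    have := aux_push g f hg hf ν μ η δ hη hηδ.le B hB
      (hp _ (hB.isCompact.image hg.continuous).isClosed).2
    simpa only [dist_comm] using this

lemma aux_le_tvDist {Z : Type*} [MeasurableSpace Z] (μ ν : Measure Z) [IsFiniteMeasure μ]
    [IsFiniteMeasure ν] (A : Set Z) (hA : MeasurableSet A) :
    |μ.real A - ν.real A| ≤ tvDist μ ν := by
  refine le_csSup ⟨μ.real Set.univ + ν.real Set.univ, ?_⟩ ⟨A, hA, rfl⟩
  rintro _ ⟨B, -, rfl⟩
  change |μ.real B - ν.real B| ≤ _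
  rw [abs_le]
  have a := measureReal_mono (μ := μ) (Set.subset_univ B)
  have b := measureReal_mono (μ := ν) (Set.subset_univ B)
  have c := measureReal_nonneg (μ := μ) (s := B)
  have d := measureReal_nonneg (μ := ν) (s := B)
  constructor <;> linarith

lemma aux_transfer (μ : Measure X) (ν : Measure Y) [IsFiniteMeasure μ] [IsFiniteMeasure ν]
    (α : Measure (X × Y)) [IsFiniteMeasure α] (R : Set (X × Y))
    (δ : ℝ) (hδ : discrepancy α μ ν + (α Rᶜ).toReal ≤ δ)
    (P : Set X) (Q : Set Y) (hP : MeasurableSet P) (hQ : MeasurableSet Q) :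
    ((∀ x y, (x, y) ∈ R → x ∈ P → y ∈ Q) → μ P ≤ ν Q + ENNReal.ofReal δ) ∧
    ((∀ x y, (x, y) ∈ R → y ∈ Q → x ∈ P) → ν Q ≤ μ P + ENNReal.ofReal δ) := by
  have h1 := abs_le.1 (aux_le_tvDist (α.map Prod.fst) μ P hP)
  have h2 := abs_le.1 (aux_le_tvDist (α.map Prod.snd) ν Q hQ)
  rw [map_measureReal_apply measurable_fst hP] at h1
  rw [map_measureReal_apply measurable_snd hQ] at h2
  have hR : α.real Rᶜ = (α Rᶜ).toReal := rfl
  unfold discrepancy at hδ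
  have hconv : ∀ a b : ENNReal, a ≠ ⊤ → b ≠ ⊤ → a.toReal ≤ b.toReal + δ →
      a ≤ b + ENNReal.ofReal δ := by
    intro a b ha hb hab
    rw [← ENNReal.ofReal_toReal ha, ← ENNReal.ofReal_toReal hb]
    exact (ENNReal.ofReal_le_ofReal hab).trans ENNReal.ofReal_add_le
  constructor
  · intro h
    refine hconv _ _ (by finiteness) (by finiteness) ?_
    change μ.real P ≤ ν.real Q + δ
    have h3 : α.real (Prod.fst ⁻¹' P) ≤ α.real (Prod.snd ⁻¹' Q) + α.real Rᶜ := by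
      refine (measureReal_mono ?_).trans (measureReal_union_le _ _)
      rintro ⟨x, y⟩ hx
      by_cases hxy : (x, y) ∈ R
      · exact Or.inl (h x y hxy hx)
      · exact Or.inr hxy
    linarith
  · intro h
    refine hconv _ _ (by finiteness) (by finiteness) ?_
    change ν.real Q ≤ μ.real P + δ
    have h3 : α.real (Prod.snd ⁻¹' Q) ≤ α.real (Prod.fst ⁻¹' P) + α.real Rᶜ := by
      refine (measureReal_mono ?_).trans (measureReal_union_le _ _)
      rintro ⟨x, y⟩ hx
      by_cases hxy : (x, y) ∈ R
      · exact Or.inl (h x y hxy hx)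
      · exact Or.inr hxy
    linarith

lemma aux_le_distortion (R : Set (X × Y)) (p q : X × Y) (hp : p ∈ R) (hq : q ∈ R) :
    |dist p.1 q.1 - dist p.2 q.2| ≤ distortion R := by
  refine le_csSup ⟨Metric.diam (Set.univ : Set X) + Metric.diam (Set.univ : Set Y), ?_⟩
    ⟨p, hp, q, hq, rfl⟩
  rintro _ ⟨p, -, q, -, rfl⟩
  have a := Metric.dist_le_diam_of_mem (isCompact_univ (X := X)).isBounded
    (Set.mem_univ p.1) (Set.mem_univ q.1)
  have b := Metric.dist_le_diam_of_mem (isCompact_univ (X := Y)).isBounded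
    (Set.mem_univ p.2) (Set.mem_univ q.2)
  have c := dist_nonneg (x := p.1) (y := q.1)
  have d := dist_nonneg (x := p.2) (y := q.2)
  rw [abs_le]
  constructor <;> linarith

lemma aux_tv0 {Z : Type*} [MeasurableSpace Z] (m : Measure Z) : tvDist m m ≤ 0 := by
  refine csSup_le ⟨_, Set.univ, MeasurableSet.univ, rfl⟩ ?_
  rintro _ ⟨A, -, rfl⟩
  simp

lemma aux_tv1 {Z : Type*} [MeasurableSpace Z] (m m' : Measure Z) [IsFiniteMeasure m']
    (hle : m ≤ m') : tvDist m m' ≤ m'.real Set.univ - m.real Set.univ := by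
  have : IsFiniteMeasure m := isFiniteMeasure_of_le m' hle
  refine csSup_le ⟨_, Set.univ, MeasurableSet.univ, rfl⟩ ?_
  rintro _ ⟨A, hA, rfl⟩
  change |m.real A - m'.real A| ≤ _
  have hl : ∀ B, m.real B ≤ m'.real B := fun B =>
    ENNReal.toReal_mono (by finiteness) (hle B)
  rw [abs_sub_comm, abs_of_nonneg (by linarith [hl A])]
  have a := hl Aᶜ
  rw [measureReal_compl hA, measureReal_compl hA] at a
  linarith

lemma aux_coupling [Nonempty X] [Nonempty Y] (μ : Measure X) (ν : Measure Y) [IsFiniteMeasure μ]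
    [IsFiniteMeasure ν] (R : Set (X × Y)) (hRc : IsClosed R) (hRn : R.Nonempty)
    (ε : ℝ) (hε : 0 ≤ ε)
    (hX : ∀ A : Set X, IsClosed A → μ A ≤ ν {y | ∃ x ∈ A, (x, y) ∈ R} + ENNReal.ofReal ε)
    (hY : ∀ B : Set Y, IsClosed B → ν B ≤ μ {x | ∃ y ∈ B, (x, y) ∈ R} + ENNReal.ofReal ε) :
    ∃ α : Measure (X × Y), IsFiniteMeasure α ∧
      discrepancy α μ ν + (α Rᶜ).toReal ≤ ε := by
  rcases le_total (μ.real Set.univ) (ν.real Set.univ) with hMN | hMN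
  · obtain ⟨α, hα, h1, h2, h3⟩ := aux_strassen μ ν R hRc hRn ε hε hMN hY
    refine ⟨α, hα, ?_⟩
    have h4 := aux_tv1 _ _ h2
    have h5 : (α.map Prod.snd).real Set.univ = μ.real Set.univ := by
      rw [← h1, map_measureReal_apply measurable_snd MeasurableSet.univ,
        map_measureReal_apply measurable_fst MeasurableSet.univ]
      rfl
    have h6 := aux_tv0 μ
    unfold discrepancy
    rw [h1]
    linarith
  · obtain ⟨β, hβ, h1, h2, h3⟩ := aux_strassen ν μ (Prod.swap ⁻¹' R)
      (hRc.preimage continuous_swap) (hRn.preimage Prod.swap_surjective) ε hε hMN hX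
    refine ⟨β.map Prod.swap, inferInstance, ?_⟩
    have h4 := aux_tv1 _ _ h2
    have h5 : (β.map Prod.snd).real Set.univ = ν.real Set.univ := by
      rw [← h1, map_measureReal_apply measurable_snd MeasurableSet.univ,
        map_measureReal_apply measurable_fst MeasurableSet.univ]
      rfl
    have h6 := aux_tv0 ν
    unfold discrepancy
    rw [Measure.map_map measurable_fst measurable_swap,
      Measure.map_map measurable_snd measurable_swap,
      Measure.map_apply measurable_swap hRc.measurableSet.compl]
    change tvDist (β.map Prod.snd) μ + tvDist (β.map Prod.fst) ν + (β (Prod.swap ⁻¹' R)ᶜ).toReal ≤ ε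
    rw [h1]
    linarith

end

lemma aux_value_nonneg {𝒳 𝒴 : PMM} (e : GHPEmbedding 𝒳 𝒴) : 0 ≤ e.value :=
  dist_nonneg.trans (le_max_left _ _)

lemma aux_cGHP_le (𝒳 𝒴 : PMM) (e : GHPEmbedding 𝒳 𝒴) (he : e.IsIsometric) :
    cGHP 𝒳 𝒴 ≤ e.value := by
  refine csInf_le ⟨0, ?_⟩ ⟨e, he, rfl⟩
  rintro _ ⟨e, -, rfl⟩
  exact aux_value_nonneg e

lemma aux_forward (𝒳 𝒴 : PMM) (h𝒳 : 𝒳.IsCompactPMM) (h𝒴 : 𝒴.IsCompactPMM) (ε : ℝ)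
    (h : cGHP 𝒳 𝒴 ≤ ε) :
    ∃ d, AuxGood 𝒳.basepoint 𝒴.basepoint 𝒳.meas 𝒴.meas ε d := by
  haveI := h𝒳.1
  haveI := h𝒴.1
  haveI : IsFiniteMeasure 𝒳.meas := ⟨h𝒳.2.lt_top⟩
  haveI : IsFiniteMeasure 𝒴.meas := ⟨h𝒴.2.lt_top⟩
  apply aux_limit
  intro n
  have hlt : cGHP 𝒳 𝒴 < ε + 1 / ((n : ℝ) + 1) := by
    have : 0 < 1 / ((n : ℝ) + 1) := by positivity
    linarith
  have hne : {x : ℝ | ∃ e : GHPEmbedding 𝒳 𝒴, e.IsIsometric ∧ x = e.value}.Nonempty :=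
    ⟨_, ⟨𝒳.carrier ⊕ 𝒴.carrier, Metric.metricSpaceSum, Sum.inl, Sum.inr⟩,
      ⟨Metric.isometry_inl, Metric.isometry_inr⟩, rfl⟩
  obtain ⟨_, ⟨e, he, rfl⟩, hv⟩ := exists_lt_of_csInf_lt hne hlt
  letI : MeasurableSpace e.Z := borel e.Z
  haveI : BorelSpace e.Z := ⟨rfl⟩
  exact ⟨_, aux_good_of_embed e.f e.g he.1 he.2 𝒳.meas 𝒴.meas 𝒳.basepoint 𝒴.basepoint _
    ((le_max_left _ _).trans_lt hv)
    (((le_max_left _ _).trans (le_max_right _ _)).trans_lt hv)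
    (((le_max_right _ _).trans (le_max_right _ _)).trans_lt hv)⟩

lemma aux_prok_le {X Y Z : Type*} [MetricSpace X] [CompactSpace X] [MeasurableSpace X]
    [BorelSpace X] [MetricSpace Y] [CompactSpace Y] [MeasurableSpace Y] [BorelSpace Y]
    [MetricSpace Z] [MeasurableSpace Z] [BorelSpace Z] (f : X → Z) (g : Y → Z)
    (hf : Isometry f) (hg : Isometry g) (μ : Measure X) (ν : Measure Y)
    [IsFiniteMeasure μ] [IsFiniteMeasure ν]
    (α : Measure (X × Y)) [IsFiniteMeasure α] (R : Set (X × Y))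
    (δ : ℝ) (hδ0 : 0 < δ) (hδ : discrepancy α μ ν + (α Rᶜ).toReal ≤ δ)
    (hR : ∀ x y, (x, y) ∈ R → dist (f x) (g y) ≤ δ) :
    prokhorovDist (μ.map f) (ν.map g) ≤ δ := by
  refine csInf_le ⟨0, fun _ h => h.1.le⟩ ⟨hδ0, fun A hA => ?_⟩
  have hT : MeasurableSet (Metric.cthickening δ A) := Metric.isClosed_cthickening.measurableSet
  have hfm := hf.continuous.measurable
  have hgm := hg.continuous.measurable
  rw [Measure.map_apply hfm hA.measurableSet, Measure.map_apply hgm hA.measurableSet,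
    Measure.map_apply hfm hT, Measure.map_apply hgm hT]
  constructor
  · refine (aux_transfer μ ν α R δ hδ _ _ (hfm hA.measurableSet) (hgm hT)).1 ?_
    intro x y hxy hx
    exact Metric.mem_cthickening_of_dist_le _ _ _ _ hx (by rw [dist_comm]; exact hR x y hxy)
  · refine (aux_transfer μ ν α R δ hδ _ _ (hfm hT) (hgm hA.measurableSet)).2 ?_
    intro x y hxy hy
    exact Metric.mem_cthickening_of_dist_le _ _ _ _ hy (hR x y hxy)

lemma aux_backward (𝒳 𝒴 : PMM) (h𝒳 : 𝒳.IsCompactPMM) (h𝒴 : 𝒴.IsCompactPMM) (ε : ℝ)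
    (hε : 0 ≤ ε) (R : Set (𝒳.carrier × 𝒴.carrier)) (α : Measure (𝒳.carrier × 𝒴.carrier))
    (hR : IsCorrespondence R) (ho : (𝒳.basepoint, 𝒴.basepoint) ∈ R) (hα : IsFiniteMeasure α)
    (hd : distortion R ≤ 2 * ε) (hD : discrepancy α 𝒳.meas 𝒴.meas + (α Rᶜ).toReal ≤ ε) :
    cGHP 𝒳 𝒴 ≤ ε := by
  haveI := h𝒳.1
  haveI := h𝒴.1
  haveI : IsFiniteMeasure 𝒳.meas := ⟨h𝒳.2.lt_top⟩
  haveI : IsFiniteMeasure 𝒴.meas := ⟨h𝒴.2.lt_top⟩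
  refine le_of_forall_gt_imp_ge_of_dense (fun δ hδ => ?_)
  have hδ0 : 0 < δ := hε.trans_lt hδ
  haveI : Nonempty R := ⟨⟨_, ho⟩⟩
  let m : MetricSpace (𝒳.carrier ⊕ 𝒴.carrier) :=
    Metric.glueMetricApprox (fun p : R => p.1.1) (fun p : R => p.1.2) δ hδ0
      (fun p q => (aux_le_distortion R p.1 q.1 p.2 q.2).trans (by linarith))
  let e : GHPEmbedding 𝒳 𝒴 := ⟨𝒳.carrier ⊕ 𝒴.carrier, m, Sum.inl, Sum.inr⟩
  have hf : Isometry e.f := Isometry.of_dist_eq (fun _ _ => rfl)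
  have hg : Isometry e.g := Isometry.of_dist_eq (fun _ _ => rfl)
  have hdist : ∀ x y, (x, y) ∈ R → dist (e.f x) (e.g y) ≤ δ := fun x y hxy =>
    (Metric.glueDist_glued_points (fun p : R => p.1.1) (fun p : R => p.1.2) δ ⟨(x, y), hxy⟩).le
  refine (aux_cGHP_le 𝒳 𝒴 e ⟨hf, hg⟩).trans ?_
  refine max_le (hdist _ _ ho) (max_le ?_ ?_)
  · refine Metric.hausdorffDist_le_of_mem_dist hδ0.le ?_ ?_
    · rintro _ ⟨x, rfl⟩
      obtain ⟨y, hy⟩ := hR.2.1 x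
      exact ⟨_, ⟨y, rfl⟩, hdist x y hy⟩
    · rintro _ ⟨y, rfl⟩
      obtain ⟨x, hx⟩ := hR.2.2 y
      exact ⟨_, ⟨x, rfl⟩, by rw [dist_comm]; exact hdist x y hx⟩
  · letI : MeasurableSpace e.Z := borel e.Z
    haveI : BorelSpace e.Z := ⟨rfl⟩
    exact aux_prok_le e.f e.g hf hg 𝒳.meas 𝒴.meas α R δ hδ0 (hD.trans hδ.le) hdist

lemma aux_iff (𝒳 𝒴 : PMM) (h𝒳 : 𝒳.IsCompactPMM) (h𝒴 : 𝒴.IsCompactPMM) (ε : ℝ) (hε : 0 ≤ ε) :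
    cGHP 𝒳 𝒴 ≤ ε ↔
      ∃ (R : Set (𝒳.carrier × 𝒴.carrier)) (α : Measure (𝒳.carrier × 𝒴.carrier)),
        IsCorrespondence R ∧ (𝒳.basepoint, 𝒴.basepoint) ∈ R ∧ IsFiniteMeasure α ∧
        distortion R ≤ 2 * ε ∧
        discrepancy α 𝒳.meas 𝒴.meas + (α Rᶜ).toReal ≤ ε := by
  constructor
  · intro h
    haveI := h𝒳.1
    haveI := h𝒴.1
    haveI : IsFiniteMeasure 𝒳.meas := ⟨h𝒳.2.lt_top⟩
    haveI : IsFiniteMeasure 𝒴.meas := ⟨h𝒴.2.lt_top⟩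
    haveI : Nonempty 𝒳.carrier := ⟨𝒳.basepoint⟩
    haveI : Nonempty 𝒴.carrier := ⟨𝒴.basepoint⟩
    obtain ⟨d, hd⟩ := aux_forward 𝒳 𝒴 h𝒳 h𝒴 ε h
    have hcont : Continuous (fun p : 𝒳.carrier × 𝒴.carrier => d p.1 p.2) := by
      have : LipschitzWith 2 (fun p : 𝒳.carrier × 𝒴.carrier => d p.1 p.2) := by
        refine LipschitzWith.of_le_add_mul 2 (fun p q => ?_)
        have h1 := hd.lip p.1 q.1 p.2 q.2
        have h2 : dist p.1 q.1 ≤ dist p q := le_max_left _ _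
        have h3 : dist p.2 q.2 ≤ dist p q := le_max_right _ _
        push_cast
        linarith
      exact this.continuous
    have hRc : IsClosed {p : 𝒳.carrier × 𝒴.carrier | d p.1 p.2 ≤ ε} :=
      isClosed_le hcont continuous_const
    have ho : (𝒳.basepoint, 𝒴.basepoint) ∈ {p : 𝒳.carrier × 𝒴.carrier | d p.1 p.2 ≤ ε} :=
      hd.base
    obtain ⟨α, hα, hD⟩ := aux_coupling 𝒳.meas 𝒴.meas _ hRc ⟨_, ho⟩ ε hε hd.mX hd.mY
    refine ⟨_, α, ⟨hRc.measurableSet, hd.left, hd.right⟩, ho, hα, ?_, hD⟩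
    refine csSup_le ⟨_, _, ho, _, ho, rfl⟩ ?_
    rintro _ ⟨p, hp, q, hq, rfl⟩
    have hp' : d p.1 p.2 ≤ ε := hp
    have hq' : d q.1 q.2 ≤ ε := hq
    exact (hd.tri p.1 q.1 p.2 q.2).trans (by linarith)
  · rintro ⟨R, α, h1, h2, h3, h4, h5⟩
    exact aux_backward 𝒳 𝒴 h𝒳 h𝒴 ε hε R α h1 h2 h3 h4 h5


/-- **Strassen-type theorem for the compact Gromov-Hausdorff-Prokhorov distance.**
For compact pmm spaces `𝒳`, `𝒴` and `ε ≥ 0`, `dc(𝒳,𝒴) ≤ ε` iff there are a correspondence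
`R` containing the roots with `dis(R) ≤ 2ε` and a finite Borel measure `α` on the product
with `D(α; μ_X, μ_Y) + α(Rᶜ) ≤ ε`.  Consequently `dc(𝒳,𝒴)` is the minimum over all such
pairs `(R, α)` of `max(dis(R)/2, D(α;μ_X,μ_Y) + α(Rᶜ))`, and the minimum is attained. -/
theorem cGHP_strassen (𝒳 𝒴 : PMM) (h𝒳 : 𝒳.IsCompactPMM) (h𝒴 : 𝒴.IsCompactPMM) :
    (∀ ε : ℝ, 0 ≤ ε → (cGHP 𝒳 𝒴 ≤ ε ↔
      ∃ (R : Set (𝒳.carrier × 𝒴.carrier)) (α : Measure (𝒳.carrier × 𝒴.carrier)),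
        IsCorrespondence R ∧ (𝒳.basepoint, 𝒴.basepoint) ∈ R ∧ IsFiniteMeasure α ∧
        distortion R ≤ 2 * ε ∧
        discrepancy α 𝒳.meas 𝒴.meas + (α Rᶜ).toReal ≤ ε)) ∧
    IsLeast {x : ℝ |
      ∃ (R : Set (𝒳.carrier × 𝒴.carrier)) (α : Measure (𝒳.carrier × 𝒴.carrier)),
        IsCorrespondence R ∧ (𝒳.basepoint, 𝒴.basepoint) ∈ R ∧ IsFiniteMeasure α ∧
        x = max (distortion R / 2)
          (discrepancy α 𝒳.meas 𝒴.meas + (α Rᶜ).toReal)}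
      (cGHP 𝒳 𝒴) := by
  have hnn : 0 ≤ cGHP 𝒳 𝒴 := by
    refine Real.sInf_nonneg ?_
    rintro _ ⟨e, -, rfl⟩
    exact aux_value_nonneg e
  have hlow : ∀ (R : Set (𝒳.carrier × 𝒴.carrier)) (α : Measure (𝒳.carrier × 𝒴.carrier)),
      IsCorrespondence R → (𝒳.basepoint, 𝒴.basepoint) ∈ R → IsFiniteMeasure α →
      cGHP 𝒳 𝒴 ≤ max (distortion R / 2) (discrepancy α 𝒳.meas 𝒴.meas + (α Rᶜ).toReal) := by
    intro R α h1 h2 h3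
    haveI := h𝒳.1
    haveI := h𝒴.1
    have h0 : 0 ≤ distortion R :=
      (abs_nonneg _).trans (aux_le_distortion R _ _ h2 h2)
    have hm := le_max_left (distortion R / 2) (discrepancy α 𝒳.meas 𝒴.meas + (α Rᶜ).toReal)
    refine (aux_iff 𝒳 𝒴 h𝒳 h𝒴 _ (by linarith)).2 ⟨R, α, h1, h2, h3, ?_, le_max_right _ _⟩
    linarith
  refine ⟨fun ε hε => aux_iff 𝒳 𝒴 h𝒳 h𝒴 ε hε, ?_, ?_⟩
  · obtain ⟨R, α, h1, h2, h3, h4, h5⟩ := (aux_iff 𝒳 𝒴 h𝒳 h𝒴 _ hnn).1 le_rfl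
    exact ⟨R, α, h1, h2, h3, le_antisymm (hlow R α h1 h2 h3) (max_le (by linarith) h5)⟩
  · rintro _ ⟨R, α, h1, h2, h3, rfl⟩
    exact hlow R α h1 h2 h3

end
end
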